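/- arXiv:math/0409551 — 3 statements merged into one kernel-verified Lean document; each statement's English description precedes it below -/
import Mathlib

section
/- Let R be a local ring (not necessarily commutative) with Jacobson radical J. Then R is right perfect if and only if every RD-flat right R-module is RD-projective. -/
universe u

open MulOpposite

section RDDefs

variable (R : Type u) [Ring R]

/-- `IsTensorZero R M N l` encodes the statement `∑ mᵢ ⊗ nᵢ = 0` in the tensor product
`M ⊗_R N` of the right `R`-module `M` with the left `R`-module `N`, via the universal
property of the tensor product: every `R`-balanced biadditive map kills the sum. -/
def IsTensorZero (M N : Type u) [AddCommGroup M] [Module Rᵐᵒᵖ M]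
    [AddCommGroup N] [Module R N] (l : List (M × N)) : Prop :=
  ∀ (A : Type u) [AddCommGroup A], ∀ b : M → N → A,
    (∀ m₁ m₂ n, b (m₁ + m₂) n = b m₁ n + b m₂ n) →
    (∀ m n₁ n₂, b m (n₁ + n₂) = b m n₁ + b m n₂) →
    (∀ (r : R) (m : M) (n : N), b (op r • m) n = b m (r • n)) →
    (l.map fun p => b p.1 p.2).sum = 0

/-- A right `R`-module `M` is RD-flat if tensoring with `M` preserves exactness of all
RD-exact sequences of left `R`-modules; equivalently, for every injective linear map
`f : H → F` of left `R`-modules whose image is a relatively divisible submodule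
(`rF ∩ f(H) = r f(H)` for all `r`), the induced map `M ⊗ H → M ⊗ F` is injective. -/
def RDFlat (M : Type u) [AddCommGroup M] [Module Rᵐᵒᵖ M] : Prop :=
  ∀ (H F : Type u) [AddCommGroup H] [Module R H] [AddCommGroup F] [Module R F],
    ∀ f : H →ₗ[R] F, Function.Injective f →
    (∀ (r : R) (h : H) (y : F), f h = r • y → ∃ h' : H, h = r • h') →
    ∀ l : List (M × H),
      IsTensorZero R M F (l.map fun p => (p.1, f p.2)) → IsTensorZero R M H l

/-- A right `R`-module `N` is RD-injective if every homomorphism into `N` from a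
relatively divisible submodule of a right `R`-module extends to the whole module. -/
def RDInjective (N : Type u) [AddCommGroup N] [Module Rᵐᵒᵖ N] : Prop :=
  ∀ (K L : Type u) [AddCommGroup K] [Module Rᵐᵒᵖ K] [AddCommGroup L] [Module Rᵐᵒᵖ L],
    ∀ f : K →ₗ[Rᵐᵒᵖ] L, Function.Injective f →
    (∀ (r : R) (k : K) (y : L), f k = op r • y → ∃ k' : K, k = op r • k') →
    ∀ g : K →ₗ[Rᵐᵒᵖ] N, ∃ h : L →ₗ[Rᵐᵒᵖ] N, h.comp f = g

/-- An injective linear map `f : K → L` of right `R`-modules is pure if every finite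
system of linear equations `∑ⱼ xⱼ aᵢⱼ = kᵢ` with constants in `K` which is solvable
in `L` is solvable in `K`. -/
def IsPure {K L : Type u} [AddCommGroup K] [Module Rᵐᵒᵖ K] [AddCommGroup L]
    [Module Rᵐᵒᵖ L] (f : K →ₗ[Rᵐᵒᵖ] L) : Prop :=
  ∀ (m n : ℕ) (a : Fin m → Fin n → R) (k : Fin m → K),
    (∃ x : Fin n → L, ∀ i, (∑ j, op (a i j) • x j) = f (k i)) →
    ∃ y : Fin n → K, ∀ i, (∑ j, op (a i j) • y j) = k i

/-- A right `R`-module `M` is RD-coflat if every RD-exact sequence `0 → M → P → Q → 0`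
is pure-exact, i.e. whenever `M` embeds as a relatively divisible submodule of a right
module `P`, it is a pure submodule of `P`. -/
def RDCoflat (M : Type u) [AddCommGroup M] [Module Rᵐᵒᵖ M] : Prop :=
  ∀ (P : Type u) [AddCommGroup P] [Module Rᵐᵒᵖ P],
    ∀ f : M →ₗ[Rᵐᵒᵖ] P, Function.Injective f →
    (∀ (r : R) (x : M) (y : P), f x = op r • y → ∃ x' : M, x = op r • x') →
    IsPure R f

/-- A right `R`-module `N` is pure-injective if every homomorphism into `N` from a pure
submodule of a right `R`-module extends to the whole module. -/
def PureInjective (N : Type u) [AddCommGroup N] [Module Rᵐᵒᵖ N] : Prop :=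
  ∀ (K L : Type u) [AddCommGroup K] [Module Rᵐᵒᵖ K] [AddCommGroup L] [Module Rᵐᵒᵖ L],
    ∀ f : K →ₗ[Rᵐᵒᵖ] L, Function.Injective f → IsPure R f →
    ∀ g : K →ₗ[Rᵐᵒᵖ] N, ∃ h : L →ₗ[Rᵐᵒᵖ] N, h.comp f = g

/-- A right `R`-module `F` is pure-projective if every homomorphism from `F` to a
quotient in a pure-exact sequence lifts. -/
def PureProjective (F : Type u) [AddCommGroup F] [Module Rᵐᵒᵖ F] : Prop :=
  ∀ (L Q : Type u) [AddCommGroup L] [Module Rᵐᵒᵖ L] [AddCommGroup Q] [Module Rᵐᵒᵖ Q],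
    ∀ p : L →ₗ[Rᵐᵒᵖ] Q, Function.Surjective p → IsPure R (LinearMap.ker p).subtype →
    ∀ g : F →ₗ[Rᵐᵒᵖ] Q, ∃ h : F →ₗ[Rᵐᵒᵖ] L, p.comp h = g

/-- A right `R`-module `F` is RD-projective if every homomorphism from `F` to a
quotient in an RD-exact sequence (the kernel is a relatively divisible submodule)
lifts. -/
def RDProjective (F : Type u) [AddCommGroup F] [Module Rᵐᵒᵖ F] : Prop :=
  ∀ (L Q : Type u) [AddCommGroup L] [Module Rᵐᵒᵖ L] [AddCommGroup Q] [Module Rᵐᵒᵖ Q],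
    ∀ p : L →ₗ[Rᵐᵒᵖ] Q, Function.Surjective p →
    (∀ (r : R) (x : L), p x = 0 → (∃ y : L, x = op r • y) →
      ∃ z : L, p z = 0 ∧ x = op r • z) →
    ∀ g : F →ₗ[Rᵐᵒᵖ] Q, ∃ h : F →ₗ[Rᵐᵒᵖ] L, p.comp h = g

end RDDefs

/-- A right `R`-module `M` is flat if tensoring with `M` preserves injectivity of all
linear maps of left `R`-modules. -/
def FlatRight (R : Type u) [Ring R] (M : Type u) [AddCommGroup M] [Module Rᵐᵒᵖ M] :
    Prop :=
  ∀ (H F : Type u) [AddCommGroup H] [Module R H] [AddCommGroup F] [Module R F],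
    ∀ f : H →ₗ[R] F, Function.Injective f →
    ∀ l : List (M × H),
      IsTensorZero R M F (l.map fun p => (p.1, f p.2)) → IsTensorZero R M H l

open scoped RightActions

section LocalFacts

variable {R : Type u} [Ring R] [IsLocalRing R]

lemma lr_comm_one {a b : R} (h : b * a = 1) : a * b = 1 := by
  have hid : (a * b) * (a * b) = a * b := by
    rw [mul_assoc, ← mul_assoc b, h, one_mul]
  rcases IsLocalRing.isUnit_or_isUnit_of_add_one (a := a * b) (b := 1 - a * b) (by simp) with hu | hu
  · exact hu.mul_left_cancel (by rw [hid, mul_one])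
  · have h0 : a * b = 0 := by
      apply hu.mul_left_cancel
      rw [sub_mul, one_mul, hid, sub_self, mul_zero]
    have : (1 : R) = 0 := by
      calc (1 : R) = (b * a) * (b * a) := by rw [h, one_mul]
        _ = b * (a * b) * a := by simp only [mul_assoc]
        _ = 0 := by rw [h0]; simp
    exact absurd this one_ne_zero

lemma lr_isUnit_right {a b : R} (h : IsUnit (b * a)) : IsUnit a := by
  obtain ⟨u, hu⟩ := h
  have h1 : (↑u⁻¹ * b) * a = 1 := by rw [mul_assoc, ← hu]; simp
  exact ⟨⟨a, ↑u⁻¹ * b, lr_comm_one h1, h1⟩, rfl⟩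

lemma lr_isUnit_left {a b : R} (h : IsUnit (b * a)) : IsUnit b := by
  obtain ⟨u, hu⟩ := h
  have h1 : b * (a * ↑u⁻¹) = 1 := by rw [← mul_assoc, ← hu]; simp
  exact ⟨⟨b, a * ↑u⁻¹, h1, lr_comm_one h1⟩, rfl⟩

lemma lr_nonunit_add {a b : R} (ha : ¬ IsUnit a) (hb : ¬ IsUnit b) : ¬ IsUnit (a + b) :=
  fun h => (IsLocalRing.isUnit_or_isUnit_of_isUnit_add h).elim ha hb

lemma lr_one_sub {a : R} (ha : ¬ IsUnit a) : IsUnit (1 - a) :=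
  (IsLocalRing.isUnit_or_isUnit_of_add_one (a := a) (b := 1 - a) (by simp)).resolve_left ha

/-- A hands-on form of Nakayama's lemma. -/
lemma lr_nakayama {α : Type*} [DecidableEq α] (t : Finset α) :
    ∀ (X : α → R) (A : α → α → R), (∀ i j, ¬ IsUnit (A i j)) →
    (∀ i ∈ t, X i = ∑ j ∈ t, A i j * X j) → ∀ i ∈ t, X i = 0 := by
  induction t using Finset.induction_on with
  | empty => simp
  | insert i0 t hi0 ih =>
    intro X A hA hX
    obtain ⟨u, hu⟩ := lr_one_sub (hA i0 i0)
    have h0 : X i0 = ∑ j ∈ t, (↑u⁻¹ * A i0 j) * X j := by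
      have := hX i0 (Finset.mem_insert_self _ _)
      rw [Finset.sum_insert hi0] at this
      have h2 : (u : R) * X i0 = ∑ j ∈ t, A i0 j * X j := by
        rw [hu, sub_mul, one_mul, sub_eq_iff_eq_add']; exact this
      simp only [mul_assoc]
      rw [← Finset.mul_sum, ← h2, ← mul_assoc]; simp
    have key : ∀ i ∈ t, X i = 0 := by
      apply ih X (fun i j => A i j + A i i0 * (↑u⁻¹ * A i0 j))
      · intro i j
        exact lr_nonunit_add (hA i j) fun h => hA i i0 (lr_isUnit_left h)
      · intro i hi
        have := hX i (Finset.mem_insert_of_mem hi)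
        rw [Finset.sum_insert hi0, h0] at this
        rw [this, Finset.mul_sum, ← Finset.sum_add_distrib]
        refine Finset.sum_congr rfl fun j _ => ?_
        rw [add_mul, ← mul_assoc (A i i0)]; abel
    intro i hi
    rcases Finset.mem_insert.1 hi with rfl | hi
    · rw [h0]
      exact Finset.sum_eq_zero fun j hj => by rw [key j hj, mul_zero]
    · exact key i hi

lemma proj_zero (P : Type u) [AddCommGroup P] [Module Rᵐᵒᵖ P] [Module.Projective Rᵐᵒᵖ P]
    (h : ∀ p : P, ∃ (p' : P) (j : R), ¬ IsUnit j ∧ p = p' <• j) (p : P) : p = 0 := by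
  classical
  obtain ⟨s, hs⟩ := Module.projective_def'.1 (inferInstance : Module.Projective Rᵐᵒᵖ P)
  have hs' : ∀ p, Finsupp.linearCombination Rᵐᵒᵖ id (s p) = p := fun p =>
    LinearMap.congr_fun hs p
  have hA : ∀ m m' : P, ¬ IsUnit (unop (s m m')) := by
    intro m m'
    obtain ⟨p', j, hj, rfl⟩ := h m
    rw [map_smul]
    simp only [Finsupp.smul_apply, smul_eq_mul, unop_mul, unop_op]
    exact fun hh => hj (lr_isUnit_right hh)
  have hx : ∀ i, s p i = ∑ j ∈ (s p).support, s p j * s j i := by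
    intro i
    conv_lhs => rw [← hs' p]
    rw [Finsupp.linearCombination_apply, Finsupp.sum, map_sum, Finsupp.finsetSum_apply]
    simp
  have := lr_nakayama (s p).support (fun i => unop (s p i)) (fun i j => unop (s j i))
    (fun i j => hA j i) (by
      intro i _
      conv_lhs => rw [hx i]
      simp)
  have h0 : s p = 0 := by
    ext i
    by_cases hi : i ∈ (s p).support
    · simpa using this i hi
    · simpa using hi
  rw [← hs' p, h0, map_zero]

end LocalFacts

section EasyDirection

lemma FlatRight.rdFlat {R : Type u} [Ring R] {M : Type u} [AddCommGroup M] [Module Rᵐᵒᵖ M]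
    (h : FlatRight R M) : RDFlat R M :=
  fun H F _ _ _ _ f hf _ => h H F f hf

lemma FlatRight.ann {R : Type u} [Ring R] {M : Type u} [AddCommGroup M] [Module Rᵐᵒᵖ M]
    (h : FlatRight R M) (m : M) (r : R) (hm : m <• r = 0) :
    m ∈ AddSubgroup.closure {z : M | ∃ (y : M) (a : R), a * r = 0 ∧ z = y <• a} := by
  set S := AddSubgroup.closure {z : M | ∃ (y : M) (a : R), a * r = 0 ∧ z = y <• a} with hS
  let H : Submodule R R := Submodule.span R {r}
  have hH : ∀ x : H, ∃ c : R, c * r = x.1 := fun x => by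
    simpa using Submodule.mem_span_singleton.1 x.2
  choose c hc using hH
  have hkey : ∀ (y : M) (x : H) (d : R), d * r = x.1 →
      (QuotientAddGroup.mk (y <• d) : M ⧸ S) = QuotientAddGroup.mk (y <• c x) := by
    intro y x d hd
    rw [QuotientAddGroup.eq]
    refine AddSubgroup.subset_closure ⟨y, c x - d, by rw [sub_mul, hc, hd, sub_self], ?_⟩
    rw [op_sub, sub_smul]; abel
  have := h H R H.subtype (Subtype.val_injective) [(m, ⟨r, Submodule.mem_span_singleton_self r⟩)]
    (by
      intro A _ b h1 h2 h3
      have h0 : b 0 1 = 0 := by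
        have := h1 0 0 1
        simpa using this
      have := h3 r m 1
      rw [hm, h0] at this
      simpa using this.symm) (M ⧸ S) (fun y x => QuotientAddGroup.mk (y <• c x))
    (fun m₁ m₂ n => by simp)
    (fun m n₁ n₂ => by
      rw [← hkey m (n₁ + n₂) (c n₁ + c n₂) (by rw [add_mul, hc, hc]; rfl)]
      rw [op_add, add_smul]; rfl)
    (fun s y n => by
      rw [← hkey y (s • n) (s * c n) (by rw [mul_assoc, hc]; rfl)]
      rw [op_mul, mul_smul])
  simp only [List.map_cons, List.map_nil, List.sum_cons, List.sum_nil, add_zero] at this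
  rw [← hkey m _ 1 (one_mul r)] at this
  simpa using this

lemma flat_rdProj_projective {R : Type u} [Ring R] {M : Type u} [AddCommGroup M]
    [Module Rᵐᵒᵖ M] (hf : FlatRight R M) (hp : RDProjective R M) :
    Module.Projective Rᵐᵒᵖ M := by
  let p : (M →₀ Rᵐᵒᵖ) →ₗ[Rᵐᵒᵖ] M := Finsupp.linearCombination Rᵐᵒᵖ id
  have hsurj : Function.Surjective p := fun m => ⟨Finsupp.single m 1, by simp [p]⟩
  obtain ⟨s, hs⟩ := hp (M →₀ Rᵐᵒᵖ) M p hsurj (by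
    rintro r x hx ⟨y, rfl⟩
    rw [map_smul] at hx
    have hk : ∀ m ∈ AddSubgroup.closure {z : M | ∃ (y : M) (a : R), a * r = 0 ∧ z = y <• a},
        ∃ w, p w = m ∧ w <• r = 0 := by
      intro m hm
      induction hm using AddSubgroup.closure_induction with
      | mem z hz =>
        obtain ⟨y, a, ha, rfl⟩ := hz
        obtain ⟨w, rfl⟩ := hsurj y
        refine ⟨w <• a, by rw [map_smul], ?_⟩
        rw [smul_smul, ← op_mul, ha, op_zero, zero_smul]
      | zero => exact ⟨0, map_zero _, smul_zero _⟩
      | add a b _ _ ha hb =>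
        obtain ⟨w, rfl, hw⟩ := ha
        obtain ⟨w', rfl, hw'⟩ := hb
        exact ⟨w + w', map_add _ _ _, by rw [smul_add, hw, hw', add_zero]⟩
      | neg a _ ha =>
        obtain ⟨w, rfl, hw⟩ := ha
        exact ⟨-w, map_neg _ _, by rw [smul_neg, hw, neg_zero]⟩
    obtain ⟨w, hw, hw'⟩ := hk _ (hf.ann (p y) r hx)
    exact ⟨y - w, by rw [map_sub, hw, sub_self], by rw [smul_sub, hw', sub_zero]⟩) LinearMap.id
  exact Module.projective_def'.2 ⟨s, hs⟩

end EasyDirection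

section Criterion

variable {R : Type u} [Ring R] {W : Type u} [AddCommGroup W] [Module R W]
  {ι : Type u} [Fintype ι]

/-- Index set of the relations `∑ gᵢ vᵢ = q w`. -/
structure RDIdx (R : Type u) [Ring R] {W : Type u} [AddCommGroup W] [Module R W]
    {ι : Type u} [Fintype ι] (v : ι → W) where
  q : R
  w : W
  g : ι → R
  eq : ∑ i, g i • v i = q • w

/-- The submodule `⊕ R q_k`. -/
noncomputable def rdD (v : ι → W) : Submodule R (RDIdx R v →₀ R) where
  carrier := {c | ∀ k, ∃ b, c k = b * k.q}
  zero_mem' := fun k => ⟨0, by simp⟩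
  add_mem' := by
    intro c c' h h' k
    obtain ⟨b, hb⟩ := h k
    obtain ⟨b', hb'⟩ := h' k
    exact ⟨b + b', by rw [Finsupp.add_apply, hb, hb', add_mul]⟩
  smul_mem' := by
    intro r c h k
    obtain ⟨b, hb⟩ := h k
    exact ⟨r * b, by rw [Finsupp.smul_apply, hb, smul_eq_mul, mul_assoc]⟩

lemma rdD_spec (v : ι → W) {c : RDIdx R v →₀ R} (hc : c ∈ rdD v) :
    ∃ b : RDIdx R v →₀ R, (∀ k, c k = b k * k.q) ∧
      Finsupp.linearCombination R (fun k : RDIdx R v => k.w) c =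
        ∑ i, (b.sum fun k r => r * k.g i) • v i := by
  classical
  choose b hb using hc
  let b' : RDIdx R v →₀ R := Finsupp.onFinset c.support (fun k => if c k = 0 then 0 else b k)
    (by intro k hk; simp only [Finsupp.mem_support_iff]; intro h; simp [h] at hk)
  have hb' : ∀ k, c k = b' k * k.q := by
    intro k
    simp only [b', Finsupp.onFinset_apply]
    split_ifs with h
    · rw [h, zero_mul]
    · exact hb k
  refine ⟨b', hb', ?_⟩
  have hsub : c.support ⊆ b'.support := by
    intro k hk
    rw [Finsupp.mem_support_iff] at hk ⊢
    intro h
    exact hk (by rw [hb', h, zero_mul])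
  rw [Finsupp.linearCombination_apply, Finsupp.sum_of_support_subset c hsub _ (by simp)]
  simp only [Finsupp.sum, Finset.sum_smul]
  rw [Finset.sum_comm]
  refine Finset.sum_congr rfl fun k _ => ?_
  rw [hb' k, mul_smul, ← k.eq, Finset.smul_sum]
  exact Finset.sum_congr rfl fun i _ => by rw [mul_smul]

/-- The map whose range is the relatively divisible hull. -/
noncomputable def rdTheta (v : ι → W) : ((ι → R) × (RDIdx R v →₀ R)) →ₗ[R] (W × ((RDIdx R v →₀ R) ⧸ rdD (R := R) v)) where
  toFun p := (∑ i, p.1 i • v i +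
    Finsupp.linearCombination R (fun k : RDIdx R v => k.w) p.2, (rdD (R := R) v).mkQ p.2)
  map_add' p p' := by
    refine Prod.ext ?_ ?_
    · simp only [Prod.fst_add, Prod.snd_add, Pi.add_apply, add_smul, Finset.sum_add_distrib, map_add]
      abel
    · simp only [Prod.snd_add, map_add]
  map_smul' r p := by
    refine Prod.ext ?_ ?_
    · simp only [Prod.smul_fst, Prod.smul_snd, Pi.smul_apply, smul_eq_mul, mul_smul,
        ← Finset.smul_sum, map_smul, smul_add, RingHom.id_apply]
    · simp only [Prod.smul_snd, map_smul, RingHom.id_apply]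

lemma rdTheta_apply (v : ι → W) (a : ι → R) (c : RDIdx R v →₀ R) :
    rdTheta v (a, c) = (∑ i, a i • v i +
      Finsupp.linearCombination R (fun k : RDIdx R v => k.w) c, (rdD v).mkQ c) := rfl

lemma rdTheta_rd_aux (v : ι → W) (r : R) (a : ι → R) (c e : RDIdx R v →₀ R) (w : W)
    (hw : ∑ i, a i • v i + Finsupp.linearCombination R (fun k : RDIdx R v => k.w) c = r • w)
    (he : c - r • e ∈ rdD v) :
    ∃ e' : RDIdx R v →₀ R,
      Finsupp.linearCombination R (fun k : RDIdx R v => k.w) e' = w ∧ r • (e' - e) ∈ rdD v := by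
  classical
  obtain ⟨b, hb, hb2⟩ := rdD_spec v he
  have h3 : ∑ i, (a i + (b.sum fun k r => r * k.g i)) • v i =
      r • (w - Finsupp.linearCombination R (fun k : RDIdx R v => k.w) e) := by
    simp only [add_smul, Finset.sum_add_distrib]
    rw [← hb2, map_sub, map_smul, smul_sub, ← hw]
    abel
  refine ⟨e + Finsupp.single ⟨r, w - Finsupp.linearCombination R (fun k : RDIdx R v => k.w) e,
    fun i => a i + (b.sum fun k r => r * k.g i), h3⟩ 1, ?_, ?_⟩
  · rw [map_add, Finsupp.linearCombination_single, one_smul]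
    exact add_sub_cancel _ _
  · generalize hk0 : (⟨r, w - Finsupp.linearCombination R (fun k : RDIdx R v => k.w) e,
      fun i => a i + (b.sum fun k r => r * k.g i), h3⟩ : RDIdx R v) = k0
    have hq : k0.q = r := by rw [← hk0]
    rw [add_sub_cancel_left]
    intro k
    by_cases hk : k0 = k
    · subst hk
      exact ⟨1, by rw [Finsupp.smul_apply, Finsupp.single_eq_same, hq]; simp⟩
    · exact ⟨0, by rw [Finsupp.smul_apply, Finsupp.single_apply, if_neg hk]; simp⟩

lemma rdTheta_rd' (v : ι → W) (r : R) (p : (ι → R) × (RDIdx R v →₀ R))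
    (y : W × ((RDIdx R v →₀ R) ⧸ rdD (R := R) v)) (hy : rdTheta v p = r • y) :
    ∃ p', rdTheta v p = r • rdTheta v p' := by
  obtain ⟨a, c⟩ := p
  obtain ⟨w, e⟩ := y
  obtain ⟨e, rfl⟩ := (rdD (R := R) v).mkQ_surjective e
  have h1 : ∑ i, a i • v i + Finsupp.linearCombination R (fun k : RDIdx R v => k.w) c = r • w :=
    congrArg Prod.fst hy
  have h2 : (rdD (R := R) v).mkQ c = r • (rdD (R := R) v).mkQ e := congrArg Prod.snd hy
  have h3 : c - r • e ∈ rdD (R := R) v := by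
    rw [← map_smul] at h2
    exact (Submodule.Quotient.eq _).1 h2
  obtain ⟨e', h4, h5⟩ := rdTheta_rd_aux v r a c e w h1 h3
  refine ⟨(0, e'), ?_⟩
  have h6 : r • (rdD (R := R) v).mkQ e' = r • (rdD (R := R) v).mkQ e := by
    rw [← map_smul, ← map_smul]
    rw [smul_sub] at h5
    exact (Submodule.Quotient.eq _).2 h5
  rw [hy, rdTheta_apply, h4]
  refine Prod.ext ?_ ?_
  · simp only [Prod.smul_fst, Pi.zero_apply, zero_smul, Finset.sum_const_zero, zero_add]
  · simp only [Prod.smul_snd]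
    exact h6.symm

lemma rdTheta_rd (v : ι → W) (r : R) (h : LinearMap.range (rdTheta (R := R) v))
    (y : W × ((RDIdx R v →₀ R) ⧸ rdD (R := R) v))
    (hy : (LinearMap.range (rdTheta (R := R) v)).subtype h = r • y) :
    ∃ h', h = r • h' := by
  obtain ⟨p, hp⟩ := h.2
  obtain ⟨p', hp'⟩ := rdTheta_rd' v r p y (hp.trans hy)
  exact ⟨⟨rdTheta v p', p', rfl⟩, Subtype.ext (hp.symm.trans hp')⟩

variable {M : Type u} [AddCommGroup M] [Module Rᵐᵒᵖ M]

/-- `m ↦ (p ↦ m p)`. -/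
noncomputable def rdAct (v : ι → W) (m : M) :
    ((ι → R) × (RDIdx R v →₀ R)) →+ ((ι → M) × (RDIdx R v →₀ M)) where
  toFun p := (fun i => m <• p.1 i, p.2.mapRange (fun r => m <• r) (by simp))
  map_zero' := by ext <;> simp
  map_add' p p' := by ext <;> simp [add_smul]

lemma rdAct_add (v : ι → W) (m m' : M) (p) :
    rdAct (R := R) v (m + m') p = rdAct v m p + rdAct v m' p := by
  ext <;> simp [rdAct]

lemma rdAct_smul (v : ι → W) (m : M) (r : R) (p) :
    rdAct (R := R) v (m <• r) p = rdAct v m (r • p) := by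
  ext <;> simp [rdAct, mul_smul]

/-- The group of all tuples having the desired form. -/
noncomputable def rdS (M : Type u) [AddCommGroup M] [Module Rᵐᵒᵖ M] (v : ι → W) : AddSubgroup (ι → M) :=
  AddSubgroup.closure {z | ∃ (y : M) (k : RDIdx R v), y <• k.q = 0 ∧ z = fun i => y <• k.g i}

lemma rdS_aux (v : ι → W) (z : (ι → M) × (RDIdx R v →₀ M))
    (hz : z ∈ AddSubgroup.closure
      {z | ∃ (m : M) (p : (ι → R) × (RDIdx R v →₀ R)), rdTheta v p = 0 ∧ z = rdAct v m p}) :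
    ∃ y : RDIdx R v →₀ M, (∀ k, z.2 k = y k <• k.q) ∧
      z.1 + (y.sum fun k m => (fun i => m <• k.g i)) ∈ rdS (R := R) M v := by
  classical
  induction hz using AddSubgroup.closure_induction with
  | mem z hz =>
    obtain ⟨m, ⟨a, c⟩, hp, rfl⟩ := hz
    rw [rdTheta_apply] at hp
    have h2 : c ∈ rdD v := by
      have := congrArg Prod.snd hp
      simpa [Submodule.mkQ_apply, Submodule.Quotient.mk_eq_zero] using this
    obtain ⟨b, hb, hb2⟩ := rdD_spec v h2
    have h3 := congrArg Prod.fst hp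
    simp only [hb2, Prod.fst_zero] at h3
    refine ⟨b.mapRange (fun r => m <• r) (by simp), ?_, ?_⟩
    · intro k
      simp [rdAct, hb, mul_smul]
    · refine AddSubgroup.subset_closure ⟨m, ⟨0, 0, fun i => a i + (b.sum fun k r => r * k.g i), ?_⟩, ?_, ?_⟩
      · rw [zero_smul, ← h3, ← Finset.sum_add_distrib]
        exact Finset.sum_congr rfl fun i _ => by rw [add_smul]
      · simp
      · rw [Finsupp.sum_mapRange_index (by intro k; ext; simp)]
        ext i
        simp only [rdAct, Pi.add_apply, AddMonoidHom.coe_mk, ZeroHom.coe_mk, Finsupp.sum, Finset.sum_apply, op_add, add_smul,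
          Finset.op_sum, Finset.sum_smul, op_mul, mul_smul]
  | zero => exact ⟨0, by simp, by simpa using zero_mem _⟩
  | add x x' _ _ hx hx' =>
    obtain ⟨y, h1, h2⟩ := hx
    obtain ⟨y', h1', h2'⟩ := hx'
    refine ⟨y + y', fun k => by simp [h1, h1'], ?_⟩
    rw [Finsupp.sum_add_index' (by intro k; ext; simp) (by intro k m m'; ext; simp)]
    convert add_mem h2 h2' using 1
    simp only [Prod.fst_add]; abel
  | neg x _ hx =>
    obtain ⟨y, h1, h2⟩ := hx
    refine ⟨-y, fun k => by simp [h1], ?_⟩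
    rw [Finsupp.sum_neg_index (by intro k; ext; simp)]
    convert neg_mem h2 using 1
    rw [neg_add]
    congr 1
    rw [Finsupp.sum, Finsupp.sum, ← Finset.sum_neg_distrib]
    refine Finset.sum_congr rfl fun k _ => ?_
    ext; simp

lemma rdFlat_criterion (hM : RDFlat R M) (v : ι → W) (x : ι → M)
    (hx : IsTensorZero R M W (Finset.univ.toList.map fun i => (x i, v i))) :
    x ∈ rdS (R := R) M v := by
  classical
  let H := LinearMap.range (rdTheta (R := R) v)
  let S' := AddSubgroup.closure
      {z | ∃ (m : M) (p : (ι → R) × (RDIdx R v →₀ R)), rdTheta v p = 0 ∧ z = rdAct v m p}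
  have hH : ∀ h : H, ∃ p, rdTheta v p = h.1 := fun h => h.2
  choose c hc using hH
  have hkey : ∀ (m : M) (h : H) (p), rdTheta v p = h.1 →
      (QuotientAddGroup.mk (rdAct v m p) : _ ⧸ S') = QuotientAddGroup.mk (rdAct v m (c h)) := by
    intro m h p hp
    rw [QuotientAddGroup.eq]
    refine AddSubgroup.subset_closure ⟨m, c h - p, by rw [map_sub, hc, hp, sub_self], ?_⟩
    rw [map_sub]; abel
  have hv : ∀ i, rdTheta (R := R) v (Pi.single i 1, 0) = (v i, 0) := by
    intro i
    rw [rdTheta_apply]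
    simp [Pi.single_apply]
  have := hM H _ H.subtype Subtype.val_injective (fun r h y => rdTheta_rd v r h y)
    (Finset.univ.toList.map fun i => (x i, ⟨rdTheta v (Pi.single i 1, 0), _, rfl⟩))
    (by
      intro A _ b h1 h2 h3
      have := hx A (fun m w => b m (w, 0)) (fun m₁ m₂ n => h1 _ _ _)
        (fun m n₁ n₂ => by rw [← h2]; simp) (fun r m n => by rw [h3]; simp)
      simpa [Function.comp_def, hv] using this)
    (_ ⧸ S') (fun m h => QuotientAddGroup.mk (rdAct v m (c h)))
    (fun m₁ m₂ n => by rw [rdAct_add]; rfl)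
    (fun m n₁ n₂ => by
      rw [← hkey m (n₁ + n₂) (c n₁ + c n₂) (by rw [map_add, hc, hc]; rfl), map_add]; rfl)
    (fun r m n => by
      rw [← hkey m (r • n) (r • c n) (by rw [map_smul, hc]; rfl), rdAct_smul])
  rw [List.map_map, Finset.sum_map_toList] at this
  have h4 : (QuotientAddGroup.mk ((x, 0) : (ι → M) × (RDIdx R v →₀ M)) : _ ⧸ S') = 0 := by
    rw [← this]
    have : ((x, 0) : (ι → M) × (RDIdx R v →₀ M)) = ∑ i, rdAct (R := R) v (x i) (Pi.single i 1, 0) := by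
      refine Prod.ext ?_ ?_
      · ext i
        rw [Prod.fst_sum, Finset.sum_apply, Finset.sum_eq_single i]
        · simp [rdAct]
        · intro j _ hj
          simp [rdAct, Pi.single_eq_of_ne hj.symm]
        · simp
      · rw [Prod.snd_sum]
        symm
        apply Finset.sum_eq_zero
        intro i _
        ext k
        simp [rdAct]
    rw [this, ← QuotientAddGroup.mk'_apply, map_sum]
    refine Finset.sum_congr rfl fun i _ => ?_
    exact hkey (x i) ⟨rdTheta v (Pi.single i 1, 0), _, rfl⟩ _ rfl
  rw [QuotientAddGroup.eq_zero_iff] at h4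
  obtain ⟨y, h5, h6⟩ := rdS_aux v _ h4
  have h7 : (y.sum fun k m => (fun i => m <• k.g i)) ∈ rdS (R := R) M v := by
    refine AddSubgroup.sum_mem _ fun k _ => AddSubgroup.subset_closure ⟨y k, k, ?_, rfl⟩
    rw [← h5]; rfl
  simpa using sub_mem h6 h7

/-- Members of `rdS` in explicit form. -/
lemma rdS_explicit (v : ι → W) (x : ι → M) (hx : x ∈ rdS (R := R) M v) :
    ∃ (κ : Type) (_ : Fintype κ) (y : κ → M) (k : κ → RDIdx R v),
      (∀ j, y j <• (k j).q = 0) ∧ ∀ i, x i = ∑ j, y j <• (k j).g i := by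
  induction hx using AddSubgroup.closure_induction with
  | mem z hz =>
    obtain ⟨y, k, h, rfl⟩ := hz
    exact ⟨Unit, inferInstance, fun _ => y, fun _ => k, fun _ => h, by simp⟩
  | zero => exact ⟨Empty, inferInstance, fun e => e.elim, fun e => e.elim, fun e => e.elim, by simp⟩
  | add x x' _ _ hx hx' =>
    obtain ⟨κ, _, y, k, h, e⟩ := hx
    obtain ⟨κ', _, y', k', h', e'⟩ := hx'
    refine ⟨κ ⊕ κ', inferInstance, Sum.elim y y', Sum.elim k k', ?_, ?_⟩
    · rintro (j | j)
      · exact h j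
      · exact h' j
    · intro i
      simp [Fintype.sum_sum_type, e, e']
  | neg x _ hx =>
    obtain ⟨κ, _, y, k, h, e⟩ := hx
    exact ⟨κ, inferInstance, fun j => - y j, k, fun j => by simp [h], fun i => by simp [e]⟩

/-- The equational criterion for RD-flatness. -/
lemma rdFlat_eq (hM : RDFlat R M) (x : ι → M) (r s : ι → R) (hr : ∀ i, x i <• r i = 0)
    (hs : ∑ i, x i <• s i = 0) :
    ∃ (κ : Type) (_ : Fintype κ) (y : κ → M) (q : κ → R) (g : ι → κ → R),
      (∀ j, y j <• q j = 0) ∧ (∀ i, x i = ∑ j, y j <• g i j) ∧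
      (∀ i j, ∃ t, g i j * r i = q j * t) ∧ (∀ j, ∃ t, ∑ i, g i j * s i = q j * t) := by
  classical
  let v : ι → ((ι → R) × R) := fun i => (Pi.single i (r i), s i)
  obtain ⟨κ, _, y, k, h1, h2⟩ := rdS_explicit v x (rdFlat_criterion hM v x (by
    intro A _ b h1 h2 h3
    rw [List.map_map, Finset.sum_map_toList]
    have hb0 : ∀ n, b 0 n = 0 := fun n => by
      have := h1 0 0 n
      simpa using this
    let B : ((ι → R) × R) → M →+ A := fun n => ⟨⟨fun m => b m n, hb0 n⟩, fun m m' => h1 m m' n⟩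
    have hB : ∀ m n, b m n = B n m := fun _ _ => rfl
    have : ∀ i, b (x i) (v i) = b (x i <• s i) (0, 1) := by
      intro i
      have : v i = r i • (Pi.single i 1, 0) + s i • (0, 1) := by
        refine Prod.ext ?_ ?_
        · ext j
          by_cases hj : i = j
          · subst hj; simp [v]
          · simp [v, Pi.single_apply, Ne.symm hj]
        · simp [v]
      rw [this, h2, ← h3, ← h3, hr, hb0, zero_add]
    simp only [Function.comp_def, this]
    simp only [hB]
    rw [← map_sum, hs, map_zero]))
  refine ⟨κ, inferInstance, y, fun j => (k j).q, fun i j => (k j).g i, h1, h2, ?_, ?_⟩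
  · intro i j
    refine ⟨(k j).w.1 i, ?_⟩
    have := congrFun (congrArg Prod.fst (k j).eq) i
    rw [Prod.fst_sum, Finset.sum_apply, Finset.sum_eq_single i] at this
    · simpa [v] using this
    · intro l _ hl
      simp [v, Pi.single_eq_of_ne hl.symm]
    · simp
  · intro j
    refine ⟨(k j).w.2, ?_⟩
    have := congrArg Prod.snd (k j).eq
    rw [Prod.snd_sum] at this
    simpa [v] using this

end Criterion

section Bass

open Filter

variable {R : Type u} [Ring R]

/-- `a (n-1) * ... * a 0`. -/
def bprod (a : ℕ → R) : ℕ → R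
  | 0 => 1
  | n + 1 => a n * bprod a n

/-- The direct limit of `R → R → ...` along left multiplications by the `a n`. -/
def bassMod (a : ℕ → R) : Submodule Rᵐᵒᵖ (Germ (atTop : Filter ℕ) R) where
  carrier := {x | ∃ f : ℕ → R, x = (f : Germ (atTop : Filter ℕ) R) ∧
    ∀ᶠ n in atTop, f (n + 1) = a n * f n}
  zero_mem' := ⟨fun _ => 0, rfl, by simp⟩
  add_mem' := by
    rintro _ _ ⟨f, rfl, hf⟩ ⟨g, rfl, hg⟩
    refine ⟨f + g, rfl, ?_⟩
    filter_upwards [hf, hg] with n h1 h2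
    simp [h1, h2, mul_add]
  smul_mem' := by
    rintro r _ ⟨f, rfl, hf⟩
    refine ⟨r • f, rfl, ?_⟩
    filter_upwards [hf] with n h1
    simp [h1, mul_assoc]

/-- The generators of the direct limit. -/
def bassGen (a : ℕ → R) (N : ℕ) : bassMod a :=
  ⟨((fun n => if N ≤ n then bprod (fun k => a (N + k)) (n - N) else 0 : ℕ → R) :
      Germ (atTop : Filter ℕ) R), _, rfl, by
    filter_upwards [eventually_ge_atTop N] with n hn
    have h1 : N ≤ n + 1 := by omega
    have h2 : n + 1 - N = (n - N) + 1 := by omega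
    rw [if_pos hn, if_pos h1, h2, bprod]
    congr 2
    omega⟩

lemma bassMod_rep (a : ℕ → R) (m : bassMod a) : ∃ f : ℕ → R,
    m.1 = (f : Germ (atTop : Filter ℕ) R) ∧ (∀ᶠ n in atTop, f (n + 1) = a n * f n) ∧
    ∀ᶠ n in atTop, m = bassGen a n <• f n := by
  obtain ⟨f, hf, hf'⟩ := m.2
  refine ⟨f, hf, hf', ?_⟩
  obtain ⟨N, hN⟩ := eventually_atTop.1 hf'
  filter_upwards [eventually_ge_atTop N] with n hn
  apply Subtype.ext
  rw [hf]
  change (f : Germ (atTop : Filter ℕ) R) = op (f n) • ((fun k => if n ≤ k then bprod (fun i => a (n + i)) (k - n) else 0 : ℕ → R) :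
      Germ (atTop : Filter ℕ) R)
  rw [← Germ.coe_smul, Germ.coe_eq]
  have : ∀ k, f (n + k) = bprod (fun i => a (n + i)) k * f n := by
    intro k
    induction k with
    | zero => simp [bprod]
    | succ k ih => rw [← add_assoc, hN _ (by omega), ih, bprod, mul_assoc]
  filter_upwards [eventually_ge_atTop n] with k hk
  have h2 := this (k - n)
  rw [show n + (k - n) = k by omega] at h2
  simp [hk, h2]

lemma bassMod_flat (a : ℕ → R) : FlatRight R (bassMod a) := by
  intro H F _ _ _ _ f hf l hl
  choose rep h1 h2 h3 using bassMod_rep a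
  have hb := hl (Germ (atTop : Filter ℕ) F)
    (fun m y => ((fun n => rep m n • y : ℕ → F) : Germ (atTop : Filter ℕ) F))
    (fun m₁ m₂ y => by
      rw [← Germ.coe_add, Germ.coe_eq]
      have : ((rep (m₁ + m₂) : ℕ → R) : Germ (atTop : Filter ℕ) R) = (rep m₁ + rep m₂ : ℕ → R) := by
        rw [← h1, Germ.coe_add, ← h1, ← h1]; rfl
      filter_upwards [Germ.coe_eq.1 this] with n hn
      rw [hn]; simp [add_smul])
    (fun m y₁ y₂ => by
      rw [← Germ.coe_add]
      congr 1
      ext n; simp)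
    (fun r m y => by
      rw [Germ.coe_eq]
      have : ((rep (m <• r) : ℕ → R) : Germ (atTop : Filter ℕ) R) = (op r • rep m : ℕ → R) := by
        rw [← h1, Germ.coe_smul, ← h1]; rfl
      filter_upwards [Germ.coe_eq.1 this] with n hn
      rw [hn]; simp [mul_smul])
  rw [List.map_map] at hb
  have hF : ∀ l : List (bassMod a × H), (l.map ((fun p : bassMod a × F => ((fun n => rep p.1 n • p.2 : ℕ → F) : Germ (atTop : Filter ℕ) F)) ∘
      fun p => (p.1, f p.2))).sum =
      ((fun n => f ((l.map fun p => rep p.1 n • p.2).sum) : ℕ → F) : Germ (atTop : Filter ℕ) F) := by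
    intro l
    induction l with
    | nil => simp; rfl
    | cons p l ih =>
      rw [List.map_cons, List.sum_cons, ih, Function.comp_apply, ← Germ.coe_add]
      congr 1
      ext n; simp
  rw [hF] at hb
  have hb' : ∀ᶠ n in atTop, (l.map fun p => rep p.1 n • p.2).sum = 0 := by
    have := Germ.coe_eq.1 (hb.trans Germ.coe_zero.symm)
    filter_upwards [this] with n hn
    exact hf (by rw [map_zero]; exact hn)
  intro A _ b b1 b2 b3
  have b0 : ∀ m, b m 0 = 0 := fun m => by
    have := b2 m 0 0
    simpa using this
  have hA : ∀ l : List (bassMod a × H), ∀ᶠ n in atTop,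
      (l.map fun p => b p.1 p.2).sum = b (bassGen a n) ((l.map fun p => rep p.1 n • p.2).sum) := by
    intro l
    induction l with
    | nil => simp [b0]
    | cons p l ih =>
      filter_upwards [ih, h3 p.1] with n hn hn'
      rw [List.map_cons, List.sum_cons, hn, List.map_cons, List.sum_cons, b2, ← b3, ← hn']
  obtain ⟨n, hn, hn'⟩ := ((hA l).and hb').exists
  rw [hn, hn', b0]

variable [IsLocalRing R]

/-- T-nilpotence of the radical of a right perfect local ring. -/
lemma bass_nilpotent (hR : ∀ (M : Type u) [AddCommGroup M] [Module Rᵐᵒᵖ M],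
      FlatRight R M → Module.Projective Rᵐᵒᵖ M) (a : ℕ → R)
    (ha : ∀ N, ∃ n ≥ N, ¬ IsUnit (a n)) : ∃ n, bprod a n = 0 := by
  have := hR _ (bassMod_flat a)
  have h0 := proj_zero (bassMod a) (by
    intro m
    obtain ⟨f, h1, h2, h3⟩ := bassMod_rep a m
    obtain ⟨N, hN⟩ := eventually_atTop.1 (h2.and h3)
    obtain ⟨n, hn, hn'⟩ := ha N
    refine ⟨bassGen a (n + 1), f (n + 1), ?_, (hN (n + 1) (by omega)).2⟩
    rw [(hN n hn).1]
    exact fun h => hn' (lr_isUnit_left h)) (bassGen a 0)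
  have h1 := congrArg Subtype.val h0
  have h2 : ((fun n => if 0 ≤ n then bprod (fun k => a (0 + k)) (n - 0) else 0 : ℕ → R) :
      Germ (atTop : Filter ℕ) R) = ((0 : ℕ → R) : Germ (atTop : Filter ℕ) R) := h1
  obtain ⟨n, hn⟩ := (Germ.coe_eq.1 h2).exists
  exact ⟨n, by simpa using hn⟩

/-- `s` induces an isomorphism `R/rR → R/r'R` -/
def RIso (r r' s : R) : Prop := IsUnit s ∧ ∃ t, IsUnit t ∧ s * r = r' * t

lemma chain_nilpotent (hT : ∀ a : ℕ → R, (∀ N, ∃ n ≥ N, ¬ IsUnit (a n)) → ∃ n, bprod a n = 0)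
    (r s : ℕ → R) (hs : ∀ k, ∃ t, s k * r k = r (k + 1) * t)
    (hn : ∀ k, ¬ RIso (r k) (r (k + 1)) (s k)) : ∃ n, bprod s n = 0 := by
  by_cases h : ∀ N, ∃ n ≥ N, ¬ IsUnit (s n)
  · exact hT s h
  exfalso
  push Not at h
  obtain ⟨N, hN⟩ := h
  choose t ht using hs
  have htn : ∀ k ≥ N, ¬ IsUnit (t k) := fun k hk hu => hn k ⟨hN k hk, t k, hu, ht k⟩
  have hr : ∀ k ≥ N, r k = 0 := by
    intro k hk
    obtain ⟨n, hn⟩ := hT (fun i => t (k + i)) (fun M => ⟨M, le_rfl, htn _ (by omega)⟩)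
    have : ∀ n, ∃ c, r k = c * r (k + n) * bprod (fun i => t (k + i)) n := by
      intro n
      induction n with
      | zero => exact ⟨1, by simp [bprod]⟩
      | succ n ih =>
        obtain ⟨c, hc⟩ := ih
        obtain ⟨u, hu⟩ := hN (k + n) (by omega)
        refine ⟨c * ↑u⁻¹, ?_⟩
        have h1 : r (k + n) = ↑u⁻¹ * (r (k + n + 1) * t (k + n)) := by
          rw [← ht, ← hu, ← mul_assoc]; simp
        rw [hc, bprod, h1]
        simp only [mul_assoc, add_assoc]
    obtain ⟨c, hc⟩ := this n
    rw [hc, hn, mul_zero]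
  exact hn N ⟨hN N le_rfl, 1, isUnit_one, by rw [hr N le_rfl, hr (N + 1) (by omega)]; simp⟩

end Bass

section Main

variable {R : Type u} [Ring R] {M : Type u} [AddCommGroup M] [Module Rᵐᵒᵖ M]

open Classical in
/-- A set of pairs `(m, r)` with `m r = 0` such that the map `⊕ R/rR → M` is locally split. -/
def RDInd (T : Set (M × R)) : Prop :=
  (∀ t ∈ T, t.1 <• t.2 = 0) ∧
  ∀ (T0 : Finset (M × R)), (∀ t ∈ T0, t ∈ T) → ∀ (κ : Type) [Fintype κ]
    (y : κ → M) (q : κ → R) (g : M × R → κ → R),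
    (∀ j, y j <• q j = 0) → (∀ t ∈ T0, t.1 = ∑ j, y j <• g t j) →
    (∀ t ∈ T0, ∀ j, q j ∣ g t j * t.2) →
    ∀ t ∈ T0, ∃ k : κ → R, (∀ j, t.2 ∣ k j * q j) ∧
      ∀ t' ∈ T0, t.2 ∣ (∑ j, k j * g t' j) - (if t' = t then 1 else 0)

/-- `m` is not in `N` plus the radical at `r`. -/
def RDGood (N : Submodule Rᵐᵒᵖ M) (m : M) (r : R) : Prop :=
  ∀ (κ : Type) [Fintype κ] (y : κ → M) (q : κ → R) (g : κ → R),
    (∀ j, y j <• q j = 0) → (∀ j, q j ∣ g j * r) → (∀ j, ¬ RIso r (q j) (g j)) →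
    m - ∑ j, y j <• g j ∉ N

lemma dvd_mul_mul {a b c d : R} (h : a ∣ b * c) (h' : c ∣ d) : a ∣ b * d := by
  obtain ⟨e, rfl⟩ := h'
  rw [← mul_assoc]
  exact h.mul_right e

lemma RDInd.insert {T : Set (M × R)} (hT : RDInd T) {m : M} {r : R} (hm : m <• r = 0)
    (hg : RDGood (Submodule.span Rᵐᵒᵖ (Prod.fst '' T)) m r) :
    RDInd (insert (m, r) T) := by
  classical
  refine ⟨?_, ?_⟩
  · rintro t (rfl | ht)
    · exact hm
    · exact hT.1 t ht
  intro T0 hT0 κ _ y q g hy hsum hdvd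
  by_cases h0 : (m, r) ∈ T0
  swap
  · refine hT.2 T0 (fun t ht => ?_) κ y q g hy hsum hdvd
    rcases hT0 t ht with rfl | h
    · exact absurd ht h0
    · exact h
  set t0 : M × R := (m, r) with ht0
  set T1 := T0.erase t0 with hT1
  have hT1T : ∀ t ∈ T1, t ∈ T := fun t ht =>
    (hT0 t (Finset.mem_of_mem_erase ht)).resolve_left (Finset.ne_of_mem_erase ht)
  have hT10 : ∀ t ∈ T1, t ∈ T0 := fun t ht => Finset.mem_of_mem_erase ht
  have hT1n : ∀ t ∈ T1, t ≠ t0 := fun t ht => Finset.ne_of_mem_erase ht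
  have hk := hT.2 T1 hT1T κ y q g hy (fun t ht => hsum t (hT10 t ht))
    (fun t ht => hdvd t (hT10 t ht))
  choose! k hk1 hk2 using hk
  have hr : ∀ j, q j ∣ g t0 j * r := hdvd t0 h0
  let a : M × R → R := fun t => ∑ j, k t j * g t0 j
  have ha : ∀ t ∈ T1, t.2 ∣ a t * r := by
    intro t ht
    simp only [a, Finset.sum_mul, mul_assoc]
    exact Finset.dvd_sum fun j _ => dvd_mul_mul (hk1 t ht j) (hr j)
  let v : κ → R := fun j => g t0 j - ∑ t ∈ T1, g t j * a t
  have hv : ∀ j, q j ∣ v j * r := by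
    intro j
    simp only [v, sub_mul, Finset.sum_mul, mul_assoc]
    exact dvd_sub (hr j) (Finset.dvd_sum fun t ht => dvd_mul_mul (hdvd t (hT10 t ht) j) (ha t ht))
  have hmem : m - ∑ j, y j <• v j ∈ Submodule.span Rᵐᵒᵖ (Prod.fst '' T) := by
    have : m - ∑ j, y j <• v j = ∑ t ∈ T1, t.1 <• a t := by
      have h1 : m = ∑ j, y j <• g t0 j := hsum t0 h0
      have h2 : ∑ t ∈ T1, t.1 <• a t = ∑ t ∈ T1, ∑ j, y j <• (g t j * a t) := by
        refine Finset.sum_congr rfl fun t ht => ?_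
        conv_lhs => rw [hsum t (hT10 t ht)]
        rw [Finset.smul_sum]
        exact Finset.sum_congr rfl fun j _ => by rw [op_mul, mul_smul]
      rw [h2, Finset.sum_comm]
      conv_lhs => rw [h1]
      rw [← Finset.sum_sub_distrib]
      refine Finset.sum_congr rfl fun j _ => ?_
      simp only [v]
      rw [op_sub, sub_smul, Finset.op_sum, Finset.sum_smul, sub_sub_cancel]
    rw [this]
    exact Submodule.sum_mem _ fun t ht => Submodule.smul_mem _ _
      (Submodule.subset_span ⟨t, hT1T t ht, rfl⟩)
  have hj0 : ∃ j, RIso r (q j) (v j) := by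
    by_contra hcon
    push Not at hcon
    exact hg κ y q v hy hv hcon hmem
  obtain ⟨j0, ⟨U, hU⟩, _, ⟨u, rfl⟩, hUu⟩ := hj0
  have hlam : ∀ x, q j0 ∣ x → r ∣ ↑U⁻¹ * x := by
    rintro _ ⟨e, rfl⟩
    refine ⟨↑u⁻¹ * e, ?_⟩
    have : q j0 = U * r * ↑u⁻¹ := by rw [hU, hUu, mul_assoc]; simp
    rw [this]
    simp [mul_assoc]
  let ρ : κ → R := fun j => ↑U⁻¹ * ((if j = j0 then 1 else 0) - ∑ t ∈ T1, g t j0 * k t j)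
  have hρ1 : ∀ j, r ∣ ρ j * q j := by
    intro j
    simp only [ρ]
    rw [mul_assoc]
    apply hlam
    rw [sub_mul, Finset.sum_mul]
    refine dvd_sub ?_ (Finset.dvd_sum fun t ht => ?_)
    · split_ifs with h
      · rw [h, one_mul]
      · simp
    · rw [mul_assoc]
      exact dvd_mul_mul (hdvd t (hT10 t ht) j0) (hk1 t ht j)
  have hρ2 : ∀ t', ∑ j, ρ j * g t' j =
      ↑U⁻¹ * (g t' j0 - ∑ t ∈ T1, g t j0 * ∑ j, k t j * g t' j) := by
    intro t'
    simp only [ρ, mul_assoc]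
    rw [← Finset.mul_sum]
    congr 1
    simp only [sub_mul, Finset.sum_sub_distrib, Finset.sum_mul, Finset.mul_sum, ite_mul, one_mul,
      zero_mul, Finset.sum_ite_eq', Finset.mem_univ, if_true, mul_assoc]
    rw [Finset.sum_comm]
  have hρ3 : ∑ j, ρ j * g t0 j = 1 := by
    rw [hρ2]
    change ↑U⁻¹ * v j0 = 1
    rw [← hU]; simp
  have hρ4 : ∀ t' ∈ T1, r ∣ ∑ j, ρ j * g t' j := by
    intro t' ht'
    rw [hρ2]
    apply hlam
    have : g t' j0 - ∑ t ∈ T1, g t j0 * ∑ j, k t j * g t' j =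
        - ∑ t ∈ T1, g t j0 * ((∑ j, k t j * g t' j) - (if t' = t then 1 else 0)) := by
      simp only [mul_sub, Finset.sum_sub_distrib, mul_ite, mul_one, mul_zero, Finset.sum_ite_eq,
        ht', if_true]
      abel
    rw [this, dvd_neg]
    exact Finset.dvd_sum fun t ht => dvd_mul_mul (hdvd t (hT10 t ht) j0) (hk2 t ht t' ht')
  intro t ht
  by_cases htt : t = t0
  · subst htt
    refine ⟨ρ, hρ1, fun t' ht' => ?_⟩
    by_cases h : t' = t0
    · rw [h, hρ3, if_pos rfl, sub_self]
      exact dvd_zero _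
    · rw [if_neg h, sub_zero]
      exact hρ4 t' (Finset.mem_erase.2 ⟨h, ht'⟩)
  · have ht1 : t ∈ T1 := Finset.mem_erase.2 ⟨htt, ht⟩
    refine ⟨fun j => k t j - a t * ρ j, fun j => ?_, fun t' ht' => ?_⟩
    · rw [sub_mul, mul_assoc]
      exact dvd_sub (hk1 t ht1 j) (dvd_mul_mul (ha t ht1) (hρ1 j))
    · have hs : ∑ j, (k t j - a t * ρ j) * g t' j =
          ∑ j, k t j * g t' j - a t * ∑ j, ρ j * g t' j := by
        simp only [sub_mul, Finset.sum_sub_distrib, Finset.mul_sum, mul_assoc]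
      rw [hs]
      by_cases h : t' = t0
      · subst h
        rw [hρ3, if_neg (Ne.symm htt), mul_one, sub_zero]
        change t.2 ∣ a t - a t
        rw [sub_self]
        exact dvd_zero _
      · have ht1' : t' ∈ T1 := Finset.mem_erase.2 ⟨h, ht'⟩
        rw [sub_right_comm]
        exact dvd_sub (hk2 t ht1 t' ht1') (dvd_mul_mul (ha t ht1) (hρ4 t' ht1'))

lemma exists_maximal_rdInd (R : Type u) [Ring R] (M : Type u) [AddCommGroup M] [Module Rᵐᵒᵖ M] :
    ∃ T : Set (M × R), Maximal RDInd T := by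
  obtain ⟨T, hT⟩ := zorn_subset {T : Set (M × R) | RDInd T} (by
    intro c hc hchain
    refine ⟨⋃₀ c, ⟨?_, ?_⟩, fun s hs => Set.subset_sUnion_of_mem hs⟩
    · rintro t ⟨s, hs, hts⟩
      exact (hc hs).1 t hts
    · intro T0 hT0
      by_cases hne : T0 = ∅
      · subst hne
        intro κ _ y q g _ _ _ t ht
        simp at ht
      have : ∃ s ∈ c, ∀ t ∈ T0, t ∈ s := by
        have hcne : c.Nonempty := by
          obtain ⟨t, ht⟩ := Finset.nonempty_iff_ne_empty.2 hne
          obtain ⟨s, hs, _⟩ := hT0 t ht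
          exact ⟨s, hs⟩
        exact hchain.directedOn.exists_mem_subset_of_finset_subset_biUnion hcne (s := T0)
          (f := fun s => s) (by
            intro t ht
            obtain ⟨s, hs, hts⟩ := hT0 t ht
            exact Set.mem_biUnion hs hts)
      obtain ⟨s, hs, h⟩ := this
      exact (hc hs).2 T0 h)
  exact ⟨T, hT⟩

lemma path_lemma
    (hT : ∀ r s : ℕ → R, (∀ k, ∃ t, s k * r k = r (k + 1) * t) →
      (∀ k, ¬ RIso (r k) (r (k + 1)) (s k)) → ∃ n, bprod s n = 0)
    (N : Submodule Rᵐᵒᵖ M) (hN : ∀ (m : M) (r : R), m <• r = 0 → ¬ RDGood N m r) (m : M) :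
    m ∈ N := by
  by_contra hm
  let σ := {x : M × R × R // x.1 <• x.2.1 = 0 ∧ x.1 <• x.2.2 ∉ N}
  have step : ∀ x : σ, ∃ (x' : σ) (s : R), (∃ t, s * x.1.2.1 = x'.1.2.1 * t) ∧
      ¬ RIso x.1.2.1 x'.1.2.1 s ∧ x'.1.2.2 = s * x.1.2.2 := by
    rintro ⟨⟨m, r, a⟩, hr, ha⟩
    have := hN m r hr
    unfold RDGood at this
    push Not at this
    obtain ⟨κ, _, y, q, g, h1, h2, h3, h4⟩ := this
    have : ∃ j, y j <• (g j * a) ∉ N := by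
      by_contra hcon
      push Not at hcon
      apply ha
      have e : m <• a = (m - ∑ j, y j <• g j) <• a + ∑ j, y j <• (g j * a) := by
        simp only [op_mul, mul_smul, smul_sub, Finset.smul_sum, sub_add_cancel]
      change m <• a ∈ N
      rw [e]
      exact N.add_mem (N.smul_mem _ h4) (N.sum_mem fun j _ => hcon j)
    obtain ⟨j, hj⟩ := this
    exact ⟨⟨⟨y j, q j, g j * a⟩, h1 j, hj⟩, g j, h2 j, h3 j, rfl⟩
  choose nx s hs1 hs2 hs3 using step
  let x0 : σ := ⟨⟨m, 0, 1⟩, by simp, by simpa using hm⟩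
  let x : ℕ → σ := fun n => nx^[n] x0
  have hx : ∀ n, x (n + 1) = nx (x n) := fun n => Function.iterate_succ_apply' nx n x0
  obtain ⟨n, hn⟩ := hT (fun n => (x n).1.2.1) (fun n => s (x n))
    (fun k => by simp only [hx]; exact hs1 (x k)) (fun k => by simp only [hx]; exact hs2 (x k))
  have : ∀ n, (x n).1.2.2 = bprod (fun n => s (x n)) n := by
    intro n
    induction n with
    | zero => rfl
    | succ n ih => rw [hx, hs3, ih, bprod]
  apply (x n).2.2
  rw [this, hn]
  simp

/-- A spanning locally split family is independent and hence `M` is RD-projective. -/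
lemma rdProjective_of_span (hM : RDFlat R M) {T : Set (M × R)} (hT : RDInd T)
    (hspan : ∀ m : M, m ∈ Submodule.span Rᵐᵒᵖ (Prod.fst '' T)) : RDProjective R M := by
  classical
  have hind : ∀ c : T →₀ Rᵐᵒᵖ, Finsupp.linearCombination Rᵐᵒᵖ (fun t : T => t.1.1) c = 0 →
      ∀ t : T, t.1.2 ∣ unop (c t) := by
    intro c hc t
    by_cases ht : t ∈ c.support
    swap
    · rw [Finsupp.notMem_support_iff.1 ht]
      simp
    obtain ⟨κ, _, y, q, g, h1, h2, h3, h4⟩ := rdFlat_eq hM (ι := c.support)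
      (fun i => i.1.1.1) (fun i => i.1.1.2) (fun i => unop (c i.1)) (fun i => hT.1 _ i.1.2) (by
        rw [Finsupp.linearCombination_apply, Finsupp.sum, ← Finset.sum_coe_sort] at hc
        simpa using hc)
    let T0 : Finset (M × R) := c.support.map (Function.Embedding.subtype _)
    let g' : M × R → κ → R := fun t => if h : ∃ h : t ∈ T, (⟨t, h⟩ : T) ∈ c.support then
      g ⟨⟨t, h.1⟩, h.2⟩ else 0
    have hg' : ∀ i : c.support, g' i.1.1 = g i := by
      rintro ⟨⟨t, ht⟩, hti⟩
      simp only [g']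
      rw [dif_pos ⟨ht, hti⟩]
    have hT0 : ∀ t ∈ T0, ∃ i : c.support, i.1.1 = t := by
      intro t ht
      simp only [T0, Finset.mem_map] at ht
      obtain ⟨i, hi, rfl⟩ := ht
      exact ⟨⟨i, hi⟩, rfl⟩
    have hT0' : ∀ i : c.support, i.1.1 ∈ T0 := by
      intro i
      simp only [T0, Finset.mem_map]
      exact ⟨i.1, i.2, rfl⟩
    obtain ⟨k, hk1, hk2⟩ := hT.2 T0 (by
        intro t ht
        obtain ⟨i, rfl⟩ := hT0 t ht
        exact i.1.2) κ y q g' h1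
      (by
        intro t ht
        obtain ⟨i, rfl⟩ := hT0 t ht
        rw [hg']
        exact h2 i)
      (by
        intro t ht
        obtain ⟨i, rfl⟩ := hT0 t ht
        rw [hg']
        exact h3 i) t.1 (hT0' ⟨t, ht⟩)
    have e1 : unop (c t) = ∑ j, k j * (∑ i : c.support, g i j * unop (c i.1)) -
        ∑ i : c.support, ((∑ j, k j * g' i.1.1 j) - (if i.1.1 = t.1 then 1 else 0)) *
          unop (c i.1) := by
      simp only [sub_mul, Finset.sum_sub_distrib, hg', Finset.sum_mul, Finset.mul_sum, mul_assoc]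
      rw [Finset.sum_comm, sub_sub_cancel]
      rw [Finset.sum_eq_single (⟨t, ht⟩ : c.support)]
      · simp
      · intro i _ hi
        rw [if_neg, zero_mul]
        intro h
        exact hi (Subtype.ext (Subtype.ext h))
      · simp
    rw [e1]
    refine dvd_sub (Finset.dvd_sum fun j _ => dvd_mul_mul (hk1 j) (h4 j)) (Finset.dvd_sum fun i _ => ?_)
    exact (hk2 _ (hT0' i)).mul_right _
  intro L Q _ _ _ _ p hp hrd f
  have hl : ∀ t : T, ∃ l : L, p l = f t.1.1 ∧ l <• t.1.2 = 0 := by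
    intro t
    obtain ⟨l, hl⟩ := hp (f t.1.1)
    obtain ⟨z, hz, hz'⟩ := hrd t.1.2 (l <• t.1.2) (by
      rw [map_smul, hl, ← map_smul, hT.1 _ t.2, map_zero]) ⟨l, rfl⟩
    exact ⟨l - z, by rw [map_sub, hl, hz, sub_zero], by rw [smul_sub, hz', sub_self]⟩
  choose l hl1 hl2 using hl
  let Φ : (T →₀ Rᵐᵒᵖ) →ₗ[Rᵐᵒᵖ] M := Finsupp.linearCombination Rᵐᵒᵖ (fun t : T => t.1.1)
  let Ψ : (T →₀ Rᵐᵒᵖ) →ₗ[Rᵐᵒᵖ] L := Finsupp.linearCombination Rᵐᵒᵖ l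
  have hΦ : Function.Surjective Φ := by
    intro m
    have := hspan m
    rw [Set.image_eq_range, Finsupp.mem_span_range_iff_exists_finsupp] at this
    obtain ⟨c, hc⟩ := this
    exact ⟨c, by simpa [Φ, Finsupp.linearCombination_apply] using hc⟩
  have hker : LinearMap.ker Φ ≤ LinearMap.ker Ψ := by
    intro c hc
    rw [LinearMap.mem_ker] at hc ⊢
    simp only [Ψ]
    rw [Finsupp.linearCombination_apply]
    refine Finset.sum_eq_zero fun t _ => ?_
    obtain ⟨e, he⟩ := hind c hc t
    have : c t = op e * op t.1.2 := by rw [← op_mul, ← he, op_unop]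
    simp only [this]
    rw [mul_smul, hl2, smul_zero]
  let h : M →ₗ[Rᵐᵒᵖ] L := ((LinearMap.ker Φ).liftQ Ψ hker).comp
    (Φ.quotKerEquivOfSurjective hΦ).symm.toLinearMap
  have hh : ∀ c, h (Φ c) = Ψ c := by
    intro c
    have : (Φ.quotKerEquivOfSurjective hΦ).symm (Φ c) = (LinearMap.ker Φ).mkQ c := by
      rw [LinearEquiv.symm_apply_eq]; rfl
    simp [h, this]
  refine ⟨h, ?_⟩
  ext m
  obtain ⟨c, rfl⟩ := hΦ m
  rw [LinearMap.comp_apply, hh]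
  simp only [Φ, Ψ, Finsupp.linearCombination_apply, Finsupp.sum, map_sum, map_smul, hl1]

end Main

/-- A local ring `R` (not necessarily commutative) is right perfect (every flat right
`R`-module is projective) if and only if every RD-flat right `R`-module is
RD-projective. -/
theorem local_rightPerfect_iff_rdFlat_rdProjective (R : Type u) [Ring R]
    [IsLocalRing R] :
    (∀ (M : Type u) [AddCommGroup M] [Module Rᵐᵒᵖ M],
      FlatRight R M → Module.Projective Rᵐᵒᵖ M) ↔
    (∀ (M : Type u) [AddCommGroup M] [Module Rᵐᵒᵖ M],
      RDFlat R M → RDProjective R M) := by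
  constructor
  · intro hR M _ _ hM
    obtain ⟨T, hT⟩ := exists_maximal_rdInd R M
    refine rdProjective_of_span hM hT.prop (path_lemma (chain_nilpotent (bass_nilpotent hR)) _ ?_)
    intro m r hm hg
    have hins := hT.prop.insert hm hg
    have hmem : (m, r) ∈ T := hT.le_of_ge hins (Set.subset_insert _ _) (Set.mem_insert _ _)
    refine hg Empty (fun e => e.elim) (fun e => e.elim) (fun e => e.elim) (fun e => e.elim)
      (fun e => e.elim) (fun e => e.elim) ?_
    simpa using Submodule.subset_span (R := Rᵐᵒᵖ) (s := Prod.fst '' T) ⟨(m, r), hmem, rfl⟩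
  · intro h M _ _ hM
    exact flat_rdProj_projective hM (h M hM.rdFlat)
end

section
/- Let R be a commutative ring. Then R is perfect if and only if every RD-flat R-module is RD-projective. -/
universe u

open MulOpposite

section RDDefsComm

variable (R : Type u) [CommRing R]

/-- `IsTensorZeroC R M N l` encodes the statement `∑ mᵢ ⊗ nᵢ = 0` in `M ⊗_R N`
(modules over a commutative ring `R`), via the universal property of the tensor
product: every `R`-balanced biadditive map kills the sum. -/
def IsTensorZeroC (M N : Type u) [AddCommGroup M] [Module R M]
    [AddCommGroup N] [Module R N] (l : List (M × N)) : Prop :=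
  ∀ (A : Type u) [AddCommGroup A], ∀ b : M → N → A,
    (∀ m₁ m₂ n, b (m₁ + m₂) n = b m₁ n + b m₂ n) →
    (∀ m n₁ n₂, b m (n₁ + n₂) = b m n₁ + b m n₂) →
    (∀ (r : R) (m : M) (n : N), b (r • m) n = b m (r • n)) →
    (l.map fun p => b p.1 p.2).sum = 0

/-- An `R`-module `M` (over a commutative ring) is RD-flat if tensoring with `M`
preserves exactness of all RD-exact sequences; equivalently, for every injective
linear map `f : H → F` whose image is a relatively divisible submodule
(`rF ∩ f(H) = r f(H)` for all `r`), the induced map `M ⊗ H → M ⊗ F` is injective. -/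
def RDFlatC (M : Type u) [AddCommGroup M] [Module R M] : Prop :=
  ∀ (H F : Type u) [AddCommGroup H] [Module R H] [AddCommGroup F] [Module R F],
    ∀ f : H →ₗ[R] F, Function.Injective f →
    (∀ (r : R) (h : H) (y : F), f h = r • y → ∃ h' : H, h = r • h') →
    ∀ l : List (M × H),
      IsTensorZeroC R M F (l.map fun p => (p.1, f p.2)) → IsTensorZeroC R M H l

/-- An `R`-module `N` is RD-injective if every homomorphism into `N` from a
relatively divisible submodule of an `R`-module extends to the whole module. -/
def RDInjectiveC (N : Type u) [AddCommGroup N] [Module R N] : Prop :=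
  ∀ (K L : Type u) [AddCommGroup K] [Module R K] [AddCommGroup L] [Module R L],
    ∀ f : K →ₗ[R] L, Function.Injective f →
    (∀ (r : R) (k : K) (y : L), f k = r • y → ∃ k' : K, k = r • k') →
    ∀ g : K →ₗ[R] N, ∃ h : L →ₗ[R] N, h.comp f = g

/-- An injective linear map `f : K → L` of `R`-modules is pure if every finite
system of linear equations with constants in `K` which is solvable in `L` is
solvable in `K`. -/
def IsPureC {K L : Type u} [AddCommGroup K] [Module R K] [AddCommGroup L]
    [Module R L] (f : K →ₗ[R] L) : Prop :=
  ∀ (m n : ℕ) (a : Fin m → Fin n → R) (k : Fin m → K),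
    (∃ x : Fin n → L, ∀ i, (∑ j, a i j • x j) = f (k i)) →
    ∃ y : Fin n → K, ∀ i, (∑ j, a i j • y j) = k i

/-- An `R`-module `M` is RD-coflat if every RD-exact sequence `0 → M → P → Q → 0`
is pure-exact, i.e. whenever `M` embeds as a relatively divisible submodule of a
module `P`, it is a pure submodule of `P`. -/
def RDCoflatC (M : Type u) [AddCommGroup M] [Module R M] : Prop :=
  ∀ (P : Type u) [AddCommGroup P] [Module R P],
    ∀ f : M →ₗ[R] P, Function.Injective f →
    (∀ (r : R) (x : M) (y : P), f x = r • y → ∃ x' : M, x = r • x') →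
    IsPureC R f

/-- An `R`-module `F` is RD-projective if every homomorphism from `F` to a quotient
in an RD-exact sequence (the kernel is a relatively divisible submodule) lifts. -/
def RDProjectiveC (F : Type u) [AddCommGroup F] [Module R F] : Prop :=
  ∀ (L Q : Type u) [AddCommGroup L] [Module R L] [AddCommGroup Q] [Module R Q],
    ∀ p : L →ₗ[R] Q, Function.Surjective p →
    (∀ (r : R) (x : L), p x = 0 → (∃ y : L, x = r • y) →
      ∃ z : L, p z = 0 ∧ x = r • z) →
    ∀ g : F →ₗ[R] Q, ∃ h : F →ₗ[R] L, p.comp h = g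

end RDDefsComm

namespace RDAux

open TensorProduct

/-! ### Flat modules and the easy direction -/

theorem rdFlat_of_flat (R : Type u) [CommRing R] (M : Type u) [AddCommGroup M] [Module R M]
    [Module.Flat R M] : RDFlatC R M := by
  intro H F _ _ _ _ f hf _ l hl A _ b h1 h2 h3
  have key : ∀ l : List (M × H), (l.map (fun p => p.1 ⊗ₜ[R] f p.2)).sum =
      f.lTensor M (l.map (fun p => p.1 ⊗ₜ[R] p.2)).sum := by
    intro l
    induction l with
    | nil => simp
    | cons p l ih => simp [ih]
  have h0 := hl (M ⊗[R] F) (fun m n => m ⊗ₜ[R] n) (fun _ _ _ => TensorProduct.add_tmul _ _ _)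
    (fun _ _ _ => TensorProduct.tmul_add _ _ _) (fun _ _ _ => TensorProduct.smul_tmul _ _ _)
  rw [List.map_map] at h0
  have h0' : f.lTensor M (l.map (fun p => p.1 ⊗ₜ[R] p.2)).sum = 0 := by
    rw [← key]; exact h0
  have hz : (l.map (fun p => p.1 ⊗ₜ[R] p.2)).sum = 0 := by
    apply Module.Flat.lTensor_preserves_injective_linearMap (M := M) f hf
    rw [h0', map_zero]
  let B : M →+ H →+ A := AddMonoidHom.mk' (fun m => AddMonoidHom.mk' (b m) (h2 m))
    (fun m₁ m₂ => by ext n; exact h1 m₁ m₂ n)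
  have hB : ∀ (r : R) (m : M) (n : H), B (r • m) n = B m (r • n) := h3
  have key2 : ∀ l : List (M × H), (l.map (fun p => b p.1 p.2)).sum =
      TensorProduct.liftAddHom (R := R) B hB (l.map (fun p => p.1 ⊗ₜ[R] p.2)).sum := by
    intro l
    induction l with
    | nil => simp
    | cons p l ih =>
      rw [List.map_cons, List.sum_cons, List.map_cons, List.sum_cons, map_add, ih,
        TensorProduct.liftAddHom_tmul]
      rfl
  rw [key2, hz, map_zero]

theorem projective_of_flat_of_rdProjective (R : Type u) [CommRing R] (M : Type u)
    [AddCommGroup M] [Module R M] [Module.Flat R M] (h : RDProjectiveC R M) :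
    Module.Projective R M := by
  let p : (M →₀ R) →ₗ[R] M := Finsupp.linearCombination R (id : M → M)
  have hp : ∀ m, p (Finsupp.single m 1) = m := fun m => by simp [p]
  obtain ⟨s, hs⟩ := h (M →₀ R) M p (fun m => ⟨_, hp m⟩) (by
    rintro r x hx ⟨y, rfl⟩
    rw [map_smul] at hx
    have : ∑ i : Fin 1, (fun _ => r) i • (fun _ => p y) i = 0 := by simpa using hx
    obtain ⟨k, a, z, hz, ha⟩ := Module.Flat.isTrivialRelation_of_sum_smul_eq_zero this
    have hz : p y = ∑ j, a 0 j • z j := hz 0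
    simp only [Finset.univ_unique, Finset.sum_singleton] at ha
    refine ⟨y - ∑ j, a 0 j • Finsupp.single (z j) 1, ?_, ?_⟩
    · simp only [map_sub, map_sum, map_smul, hp]
      rw [hz, sub_self]
    · rw [smul_sub, Finset.smul_sum]
      have : ∀ j, r • a 0 j • Finsupp.single (z j) (1 : R) = 0 := fun j => by
        rw [smul_smul]
        have := ha j
        rw [show r * a 0 j = 0 from this, zero_smul]
      rw [Finset.sum_congr rfl fun j _ => this j, Finset.sum_const_zero, sub_zero]) LinearMap.id
  exact Module.Projective.of_split s p hs

/-! ### The descending chain condition on principal ideals (Bass) -/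

section Bass

variable {R : Type u} [CommRing R] (a : ℕ → R)

/-- eventually zero sequences -/
def evZero (R : Type u) [CommRing R] : Submodule R (ℕ → R) where
  carrier := {f | ∃ N, ∀ t, N ≤ t → f t = 0}
  add_mem' := by
    rintro f g ⟨N, hN⟩ ⟨K, hK⟩
    refine ⟨max N K, fun t ht => ?_⟩
    rw [Pi.add_apply, hN t (le_trans (le_max_left _ _) ht),
      hK t (le_trans (le_max_right _ _) ht), add_zero]
  zero_mem' := ⟨0, fun _ _ => rfl⟩
  smul_mem' := by
    rintro c f ⟨N, hN⟩
    exact ⟨N, fun t ht => by rw [Pi.smul_apply, hN t ht, smul_zero]⟩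

/-- The generators of the Bass module. -/
def bassX (n : ℕ) : (ℕ → R) ⧸ evZero R :=
  (evZero R).mkQ (fun t => ∏ i ∈ Finset.Ico n t, a i)

theorem bassX_smul_eq_zero {r : R} {n : ℕ} (h : r • bassX a n = 0) :
    ∃ N, n ≤ N ∧ ∀ t, N ≤ t → r * ∏ i ∈ Finset.Ico n t, a i = 0 := by
  rw [bassX, ← map_smul, Submodule.mkQ_apply, Submodule.Quotient.mk_eq_zero] at h
  obtain ⟨N, hN⟩ := h
  exact ⟨max n N, le_max_left _ _, fun t ht => hN t (le_trans (le_max_right _ _) ht)⟩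

theorem bassX_eq {n m : ℕ} (h : n ≤ m) :
    bassX a n = (∏ i ∈ Finset.Ico n m, a i) • bassX a m := by
  rw [bassX, bassX, ← map_smul, Submodule.mkQ_apply, Submodule.mkQ_apply,
    Submodule.Quotient.eq]
  refine ⟨m, fun t ht => ?_⟩
  simp only [Pi.sub_apply, Pi.smul_apply, smul_eq_mul]
  rw [Finset.prod_Ico_consecutive _ h ht, sub_self]

/-- The Bass module. -/
def bassF : Submodule R ((ℕ → R) ⧸ evZero R) := Submodule.span R (Set.range (bassX a))

theorem bassX_mem (n : ℕ) : bassX a n ∈ bassF a := Submodule.subset_span ⟨n, rfl⟩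

theorem bassF_exists {x : (ℕ → R) ⧸ evZero R} (hx : x ∈ bassF a) :
    ∃ n, ∀ m, n ≤ m → ∃ r : R, x = r • bassX a m := by
  induction hx using Submodule.span_induction with
  | mem x h =>
    obtain ⟨n, rfl⟩ := h
    exact ⟨n, fun m hm => ⟨_, bassX_eq a hm⟩⟩
  | zero => exact ⟨0, fun m _ => ⟨0, by simp⟩⟩
  | add x y _ _ hx hy =>
    obtain ⟨n, hn⟩ := hx
    obtain ⟨k, hk⟩ := hy
    refine ⟨max n k, fun m hm => ?_⟩
    obtain ⟨r, rfl⟩ := hn m (le_trans (le_max_left _ _) hm)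
    obtain ⟨s, rfl⟩ := hk m (le_trans (le_max_right _ _) hm)
    exact ⟨r + s, by rw [add_smul]⟩
  | smul c x _ hx =>
    obtain ⟨n, hn⟩ := hx
    refine ⟨n, fun m hm => ?_⟩
    obtain ⟨r, rfl⟩ := hn m hm
    exact ⟨c * r, by rw [mul_smul]⟩

theorem bassF_flat : Module.Flat R (bassF a) := by
  apply Module.Flat.of_forall_isTrivialRelation
  intro l f x hfx
  choose n hn using fun i => bassF_exists a (x i).2
  obtain ⟨N, hN⟩ : ∃ N, ∀ i, n i ≤ N :=
    ⟨Finset.univ.sup n, fun i => Finset.le_sup (f := n) (Finset.mem_univ i)⟩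
  choose r hr using fun i => hn i N (hN i)
  have h0 : (∑ i, f i * r i) • bassX a N = 0 := by
    have := congrArg (Subtype.val) hfx
    simp only [AddSubmonoidClass.coe_finsetSum, Submodule.coe_smul, ZeroMemClass.coe_zero] at this
    rw [← this, Finset.sum_smul]
    exact Finset.sum_congr rfl fun i _ => by rw [hr i, mul_smul]
  obtain ⟨K, hNK, hK⟩ := bassX_smul_eq_zero a h0
  refine ⟨1, fun i _ => r i * ∏ i ∈ Finset.Ico N K, a i, fun _ => ⟨bassX a K, bassX_mem a K⟩,
    fun i => ?_, fun _ => ?_⟩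
  · apply Subtype.ext
    simp only [Finset.univ_unique, Finset.sum_singleton, Submodule.coe_smul]
    rw [hr i, bassX_eq a hNK, smul_smul]
  · rw [← hK K le_rfl, Finset.sum_mul]
    exact Finset.sum_congr rfl fun i _ => by ring

theorem bass_stab (hR : Module.Projective R (bassF a)) :
    ∃ m, ∀ n, (∏ i ∈ Finset.range n, a i) ∣ ∏ i ∈ Finset.range m, a i := by
  let x : ℕ → bassF a := fun n => ⟨bassX a n, bassX_mem a n⟩
  let p : (ℕ →₀ R) →ₗ[R] bassF a := Finsupp.linearCombination R x
  have hp : Function.Surjective p := by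
    rintro ⟨y, hy⟩
    obtain ⟨n, hn⟩ := bassF_exists a hy
    obtain ⟨r, rfl⟩ := hn n le_rfl
    exact ⟨Finsupp.single n r, Subtype.ext (by simp [p, x])⟩
  obtain ⟨s, hs⟩ := Module.projective_lifting_property p LinearMap.id hp
  let c := s (x 0)
  have hc : ∀ n i, (∏ i ∈ Finset.range n, a i) ∣ c i := by
    intro n i
    have : x 0 = (∏ i ∈ Finset.range n, a i) • x n := by
      apply Subtype.ext
      have := bassX_eq a (Nat.zero_le n)
      rw [← Finset.range_eq_Ico] at this
      exact this
    refine ⟨s (x n) i, ?_⟩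
    simp only [c]
    rw [this, map_smul]
    rfl
  have hx0 : p c = x 0 := LinearMap.congr_fun hs (x 0)
  obtain ⟨N, hN⟩ : ∃ N, ∀ i ∈ c.support, i ≤ N :=
    ⟨c.support.sup id, fun i hi => Finset.le_sup (f := id) hi⟩
  have h1 : (∏ i ∈ Finset.range N, a i - ∑ i ∈ c.support, c i * ∏ j ∈ Finset.Ico i N, a j) •
      bassX a N = 0 := by
    rw [sub_smul, Finset.sum_smul, Finset.range_eq_Ico, ← bassX_eq a (Nat.zero_le N), sub_eq_zero]
    have := congrArg Subtype.val hx0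
    simp only [p, Finsupp.linearCombination_apply, Finsupp.sum,
      AddSubmonoidClass.coe_finsetSum, Submodule.coe_smul, x] at this
    rw [← this]
    exact Finset.sum_congr rfl fun i hi => by rw [mul_smul, ← bassX_eq a (hN i hi)]
  obtain ⟨K, hNK, hK⟩ := bassX_smul_eq_zero a h1
  refine ⟨K, fun n => ?_⟩
  have h2 := hK K le_rfl
  rw [sub_mul, Finset.range_eq_Ico, Finset.prod_Ico_consecutive _ (Nat.zero_le N) hNK,
    sub_eq_zero] at h2
  rw [Finset.range_eq_Ico K, h2]
  exact Dvd.dvd.mul_right (Finset.dvd_sum fun i _ => Dvd.dvd.mul_right (hc n i) _) _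

end Bass

/-- Strict divisibility: `b` generates a strictly smaller ideal than `a`. -/
def SDvd {R : Type u} [CommRing R] (b a : R) : Prop := a ∣ b ∧ ¬ b ∣ a

theorem wf_sdvd (R : Type u) [CommRing R]
    (hR : ∀ (M : Type u) [AddCommGroup M] [Module R M],
      Module.Flat R M → Module.Projective R M) : WellFounded (SDvd (R := R)) := by
  rw [wellFounded_iff_isEmpty_descending_chain]
  refine ⟨fun ⟨f, hf⟩ => ?_⟩
  choose b hb using fun n => (hf n).1
  let a : ℕ → R := fun n => Nat.casesOn n (f 0) b
  have hprod : ∀ n, ∏ i ∈ Finset.range (n + 1), a i = f n := by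
    intro n
    induction n with
    | zero => simp [a]
    | succ n ih => rw [Finset.prod_range_succ, ih, hb n]
  obtain ⟨m, hm⟩ := bass_stab a (hR _ (bassF_flat a))
  have h1 := hm (m + 2)
  rw [hprod] at h1
  apply (hf m).2
  refine h1.trans ?_
  rw [← hprod m, Finset.prod_range_succ]
  exact dvd_mul_right _ _

end RDAux

namespace RDAux

/-! ### Local idempotents and chain conditions -/

theorem exists_local_idem {R : Type u} [CommRing R] (wf : WellFounded (SDvd (R := R)))
    (M : Type u) [AddCommGroup M] [Module R M] [Nontrivial M] :
    ∃ e : R, e * e = e ∧ (∃ y : M, e • y ≠ 0) ∧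
      ∀ t : R, (∃ v, e = t * v) ∨ (∃ k : ℕ, e * t ^ k = 0) := by
  obtain ⟨y0, hy0⟩ := exists_ne (0 : M)
  obtain ⟨e, ⟨he, y, hy⟩, hmin⟩ := wf.has_min {e : R | e * e = e ∧ ∃ y : M, e • y ≠ 0}
    ⟨1, by simp, y0, by simpa using hy0⟩
  refine ⟨e, he, ⟨y, hy⟩, fun t => ?_⟩
  obtain ⟨x, ⟨n, rfl⟩, hn⟩ := wf.has_min (Set.range fun n : ℕ => e * t ^ (n + 1)) ⟨_, 0, rfl⟩
  have h1 := hn (e * t ^ (2 * n + 1 + 1)) ⟨2 * n + 1, rfl⟩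
  simp only [SDvd, not_and, not_not] at h1
  obtain ⟨w, hw⟩ := h1 ⟨t ^ (n + 1), by ring⟩
  set g := e * t ^ (n + 1) * w with hg
  have heg : e * g = g := by rw [hg]; linear_combination (t ^ (n + 1) * w) * he
  have hgg : g * g = g := by
    have : g * g = (e * e) * t ^ (2 * n + 1 + 1) * w * w := by rw [hg]; ring
    rw [this, he, ← hw]
  by_cases hgy : ∃ y : M, g • y ≠ 0
  · left
    have := hmin g ⟨hgg, hgy⟩
    simp only [SDvd, not_and, not_not] at this
    obtain ⟨v, hv⟩ := this ⟨g, heg.symm⟩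
    exact ⟨e * t ^ n * w * v, hv.trans (by rw [hg]; ring)⟩
  · right
    push Not at hgy
    have := hmin (e - g) ⟨by linear_combination he + hgg - 2 * heg,
      y, by rw [sub_smul, hgy, sub_zero]; exact hy⟩
    simp only [SDvd, not_and, not_not] at this
    obtain ⟨v, hv⟩ := this ⟨e - g, by linear_combination heg - he⟩
    have hg0 : g = 0 := by linear_combination (-1 : R) * heg + g * hv - v * hgg + v * heg
    refine ⟨n + 1, ?_⟩
    rw [hw]
    linear_combination t ^ (n + 1) * hg0 - t ^ (n + 1) * hg

/-- The ascending relation on principal ideals containing `1 - e`. -/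
def Asc {R : Type u} [CommRing R] (e : R) (s' s : R) : Prop :=
  s ∣ 1 - e ∧ s' ∣ s ∧ ¬ s ∣ s'

theorem wf_asc {R : Type u} [CommRing R] (wf : WellFounded (SDvd (R := R))) (e : R)
    (hloc : ∀ t : R, (∃ v, e = t * v) ∨ (∃ k : ℕ, e * t ^ k = 0)) :
    WellFounded (Asc e) := by
  rw [wellFounded_iff_isEmpty_descending_chain]
  refine ⟨fun ⟨s, hs⟩ => ?_⟩
  choose b hb using fun n => (hs n).2.1
  have hnil : ∀ n, ∃ k : ℕ, e * b n ^ k = 0 := by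
    intro n
    refine (hloc (b n)).resolve_left ?_
    rintro ⟨v, hv⟩
    apply (hs n).2.2
    obtain ⟨q, hq⟩ := (hs n).1
    refine ⟨v + q * s (n + 1), ?_⟩
    linear_combination s (n + 1) * hq + s (n + 1) * hv - v * hb n
  have hzero : ∀ m, e * s m = 0 := by
    intro m
    obtain ⟨x, ⟨n, rfl⟩, hn⟩ := wf.has_min
      (Set.range fun n : ℕ => e * ∏ i ∈ Finset.range n, b (m + i)) ⟨_, 0, rfl⟩
    have h1 := hn (e * ∏ i ∈ Finset.range (n + 1), b (m + i)) ⟨n + 1, rfl⟩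
    simp only [SDvd, not_and, not_not] at h1
    obtain ⟨d, hd⟩ := h1 ⟨b (m + n), by rw [Finset.prod_range_succ]; ring⟩
    rw [Finset.prod_range_succ] at hd
    set p := ∏ i ∈ Finset.range n, b (m + i) with hp
    have hk : ∀ k : ℕ, e * p = e * p * (b (m + n) * d) ^ k := by
      intro k
      induction k with
      | zero => simp
      | succ k ih => rw [pow_succ]; linear_combination (b (m + n) * d) * ih + hd
    obtain ⟨k, hk0⟩ := hnil (m + n)
    have hp0 : e * p = 0 := by
      rw [hk k, mul_pow]
      linear_combination p * d ^ k * hk0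
    have hprod : ∀ n, s m = s (m + n) * ∏ i ∈ Finset.range n, b (m + i) := by
      intro n
      induction n with
      | zero => simp
      | succ n ih =>
        rw [Finset.prod_range_succ, ih, hb (m + n), ← add_assoc]; ring
    rw [hprod n]
    linear_combination s (m + n) * hp0
  apply (hs 0).2.2
  obtain ⟨q, hq⟩ := (hs 0).1
  refine ⟨q * s (0 + 1), ?_⟩
  linear_combination s (0 + 1) * hq + hzero (0 + 1)

theorem crux {R : Type u} [CommRing R] (wf : WellFounded (SDvd (R := R)))
    (M : Type u) [AddCommGroup M] [Module R M] [Nontrivial M] :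
    ∃ (s : R) (y : M), y ≠ 0 ∧ s • y = 0 ∧
      ∀ (ι : Type u) (S : Finset ι) (b r : ι → R) (z : ι → M),
        (∀ i ∈ S, r i • z i = 0) → (∀ i ∈ S, r i ∣ b i * s) → y = ∑ i ∈ S, b i • z i →
        ∃ i ∈ S, ∃ w, s ∣ r i * w ∧ s ∣ 1 - b i * w := by
  obtain ⟨e, he, ⟨y0, hy0⟩, hloc⟩ := exists_local_idem wf M
  obtain ⟨c, ⟨s0, y1, hs0, hsy1, hcy1⟩, hcmin⟩ := wf.has_min
    {c : R | ∃ (s : R) (y : M), s ∣ 1 - e ∧ s • y = 0 ∧ c • y ≠ 0}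
    ⟨1, 1 - e, e • y0, dvd_rfl, by rw [smul_smul, sub_mul, he, one_mul, sub_self, zero_smul],
      by rwa [one_smul]⟩
  obtain ⟨s, ⟨hs, y, hsy, hcy⟩, hsmin⟩ := (wf_asc wf e hloc).has_min
    {s : R | s ∣ 1 - e ∧ ∃ y : M, s • y = 0 ∧ c • y ≠ 0} ⟨s0, hs0, y1, hsy1, hcy1⟩
  have key : ∀ (s : R) (y : M), s ∣ 1 - e → s • y = 0 → e • y = y := by
    rintro s y ⟨q, hq⟩ h
    have : e = 1 - q * s := by linear_combination -hq
    rw [this, sub_smul, mul_smul, h, smul_zero, one_smul, sub_zero]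
  refine ⟨s, y, fun h => hcy (by rw [h, smul_zero]), hsy, ?_⟩
  intro ι S b r z hrz hrb hy
  have hey := key s y hs hsy
  obtain ⟨j, hj, hjne⟩ : ∃ j ∈ S, (c * b j) • (e • z j) ≠ 0 := by
    by_contra! hcon
    apply hcy
    rw [← hey, hy, Finset.smul_sum, Finset.smul_sum]
    refine Finset.sum_eq_zero fun i hi => ?_
    rw [← hcon i hi]
    simp only [smul_smul]
    congr 1; ring
  have hz1 : (e * r j + (1 - e)) • (e • z j) = 0 := by
    have : (e * r j + (1 - e)) * e = e * r j := by linear_combination (r j - 1) * he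
    rw [smul_smul, this, mul_smul, hrz j hj, smul_zero]
  have hdiv : e * r j + (1 - e) ∣ 1 - e := ⟨1 - e, by linear_combination (r j - 1) * he⟩
  have h1 := hcmin (c * b j) ⟨_, _, hdiv, hz1, hjne⟩
  simp only [SDvd, not_and, not_not] at h1
  obtain ⟨d, hd⟩ := h1 (dvd_mul_right _ _)
  have hce : c * e ≠ 0 := by
    intro h
    apply hcy
    rw [← hey, smul_smul, h, zero_smul]
  obtain ⟨v, hv⟩ : ∃ v, e = b j * v := by
    refine (hloc (b j)).resolve_right ?_
    rintro ⟨k, hk⟩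
    apply hce
    have hpow : ∀ k : ℕ, c = c * (b j * d) ^ k := by
      intro k
      induction k with
      | zero => simp
      | succ k ih =>
        rw [pow_succ]
        linear_combination ih * (b j * d) + hd
    rw [hpow k, mul_pow]
    linear_combination c * d ^ k * hk
  obtain ⟨q, hq⟩ := hrb j hj
  have hss : e * r j + (1 - e) ∣ s := by
    refine ⟨e * q * v + (1 - e) * s, ?_⟩
    linear_combination s * e * hv - s * he + e * v * hq +
      (r j * s + q * v - s - r j * q * v) * he
  have h2 := hsmin (e * r j + (1 - e)) ⟨hdiv, e • z j, hz1, fun h => hjne (by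
    rw [mul_comm, mul_smul, h, smul_zero])⟩
  simp only [Asc, not_and, not_not] at h2
  obtain ⟨x, hx⟩ := h2 hs hss
  refine ⟨j, hj, e * v, ⟨x * e * v, ?_⟩, ?_⟩
  · linear_combination e * v * hx - v * (r j - 1) * he
  · have : 1 - b j * (e * v) = 1 - e := by linear_combination e * hv - he
    rw [this]; exact hs

end RDAux

namespace RDAux

open DirectSum

/-! ### Pure submodules and lifting of finite systems -/

section Pure

variable {R : Type u} [CommRing R]

/-- Solutions of finite homogeneous linear systems lift along `q`. -/
def SysLift {P M : Type u} [AddCommGroup P] [Module R P] [AddCommGroup M] [Module R M]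
    (q : P →ₗ[R] M) : Prop :=
  ∀ (ι κ : Type) [Fintype ι] [Fintype κ] (a : ι → κ → R) (x : κ → M),
    (∀ i, ∑ j, a i j • x j = 0) →
    ∃ x' : κ → P, (∀ j, q (x' j) = x j) ∧ ∀ i, ∑ j, a i j • x' j = 0

/-- Pure submodules. -/
def PureSub {M : Type u} [AddCommGroup M] [Module R M] (N : Submodule R M) : Prop :=
  ∀ (ι κ : Type) [Fintype ι] [Fintype κ] (a : ι → κ → R) (x : κ → M),
    (∀ i, ∑ j, a i j • x j ∈ N) →
    ∃ y : κ → M, (∀ j, y j ∈ N) ∧ ∀ i, ∑ j, a i j • y j = ∑ j, a i j • x j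

variable {M : Type u} [AddCommGroup M] [Module R M]

theorem sysLift_mkQ {N : Submodule R M} (hN : PureSub N) : SysLift N.mkQ := by
  intro ι κ _ _ a x hx
  choose x0 hx0 using fun j => N.mkQ_surjective (x j)
  obtain ⟨y, hy, hya⟩ := hN ι κ a x0 (fun i => by
    rw [← Submodule.Quotient.mk_eq_zero, ← Submodule.mkQ_apply, map_sum, ← hx i]
    exact Finset.sum_congr rfl fun j _ => by rw [map_smul, hx0])
  refine ⟨fun j => x0 j - y j, fun j => ?_, fun i => ?_⟩
  · rw [map_sub, hx0, Submodule.mkQ_apply, (Submodule.Quotient.mk_eq_zero N).2 (hy j), sub_zero]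
  · simp only [smul_sub, Finset.sum_sub_distrib, hya, sub_self]

theorem SysLift.comp {P L : Type u} [AddCommGroup P] [Module R P] [AddCommGroup L] [Module R L]
    {q : P →ₗ[R] M} {q' : M →ₗ[R] L} (h' : SysLift q') (h : SysLift q) :
    SysLift (q'.comp q) := by
  intro ι κ _ _ a x hx
  obtain ⟨x1, h1, h1'⟩ := h' ι κ a x hx
  obtain ⟨x2, h2, h2'⟩ := h ι κ a x1 h1'
  exact ⟨x2, fun j => by rw [LinearMap.comp_apply, h2, h1], h2'⟩

theorem exists_pure_cyclic (wf : WellFounded (SDvd (R := R))) [Nontrivial M]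
    {ι : Type u} (r : ι → R) (q : (⨁ i, R ⧸ Ideal.span {r i}) →ₗ[R] M) (hq : SysLift q) :
    ∃ (s : R) (y : M), y ≠ 0 ∧ s • y = 0 ∧ (∀ c : R, c • y = 0 → s ∣ c) ∧
      PureSub (Submodule.span R {y}) := by
  classical
  obtain ⟨s, y, hy0, hsy, hy⟩ := crux wf M
  have ret : ∀ x : ⨁ i, R ⧸ Ideal.span {r i}, q x = y → s • x = 0 →
      ∃ ρ : (⨁ i, R ⧸ Ideal.span {r i}) →ₗ[R] R ⧸ Ideal.span {s}, ρ x = 1 := by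
    intro x hqx hsx
    choose b hb using fun i => Ideal.Quotient.mk_surjective (x i)
    have hone : ∀ i (c : R), (Ideal.Quotient.mk (Ideal.span {r i}) c) =
        c • (1 : R ⧸ Ideal.span {r i}) := by
      intro i c
      rw [Algebra.smul_def, mul_one]; rfl
    obtain ⟨i, hi, w, hw1, hw2⟩ := hy ι (DFinsupp.support x) b r
      (fun i => q (DirectSum.lof R ι (fun i => R ⧸ Ideal.span {r i}) i 1))
      (by
        intro i _
        rw [← map_smul, ← map_smul, ← hone,
          Ideal.Quotient.eq_zero_iff_mem.2 (Ideal.mem_span_singleton_self _), map_zero, map_zero])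
      (by
        intro i _
        rw [← Ideal.mem_span_singleton, ← Ideal.Quotient.eq_zero_iff_mem, mul_comm, map_mul, hb]
        have : (s • x) i = 0 := by rw [hsx]; rfl
        rw [← this, DirectSum.smul_apply, Algebra.smul_def]; rfl)
      (by
        rw [← hqx]
        conv_lhs => rw [← DirectSum.sum_support_of x]
        rw [map_sum]
        refine Finset.sum_congr rfl fun i _ => ?_
        rw [← map_smul, ← map_smul, ← hone, hb]
        rfl)
    have hle : Ideal.span {r i} ≤
        LinearMap.ker ((Submodule.mkQ (Ideal.span {s})).comp (LinearMap.mulLeft R w)) := by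
      rw [Ideal.span_le, Set.singleton_subset_iff]
      show (Ideal.Quotient.mk (Ideal.span {s})) (w * r i) = 0
      rw [Ideal.Quotient.eq_zero_iff_mem, Ideal.mem_span_singleton, mul_comm]
      exact hw1
    refine ⟨(Submodule.liftQ _ _ hle).comp
      (DirectSum.component R ι (fun i => R ⧸ Ideal.span {r i}) i), ?_⟩
    rw [LinearMap.comp_apply, DirectSum.apply_eq_component R x i |>.symm, ← hb i]
    show (Ideal.Quotient.mk (Ideal.span {s})) (w * b i) = (Ideal.Quotient.mk (Ideal.span {s})) 1
    rw [eq_comm, Ideal.Quotient.mk_eq_mk_iff_sub_mem, Ideal.mem_span_singleton, mul_comm]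
    exact hw2
  have hinj : ∀ c : R, c • y = 0 → s ∣ c := by
    intro c hc
    obtain ⟨x, hx, hxa⟩ := hq Bool Unit (fun i _ => if i then c else s) (fun _ => y) (by
      intro i
      cases i <;> simp [hc, hsy])
    have h1 := hxa true
    have h2 := hxa false
    simp only [Finset.univ_unique, Finset.sum_singleton, if_true, Bool.false_eq_true, if_false]
      at h1 h2
    obtain ⟨ρ, hρ⟩ := ret _ (hx default) h2
    have := congrArg ρ h1
    rw [map_smul, hρ, map_zero, Algebra.smul_def, mul_one] at this
    exact Ideal.mem_span_singleton.1 (Ideal.Quotient.eq_zero_iff_mem.1 this)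
  refine ⟨s, y, hy0, hsy, hinj, ?_⟩
  intro I J _ _ a x hx
  choose k hk using fun i => Submodule.mem_span_singleton.1 (hx i)
  obtain ⟨x', hx', hxa⟩ := hq (Option I) (Option J)
    (fun i j => Option.elim i (Option.elim j s (fun _ => 0))
      (fun i => Option.elim j (-k i) (fun j => a i j)))
    (fun j => Option.elim j y x) (by
      intro i
      cases i with
      | none => simp [Fintype.sum_option, hsy]
      | some i => simp [Fintype.sum_option, hk])
  have h0 := hxa none
  simp only [Fintype.sum_option, Option.elim, zero_smul, Finset.sum_const_zero, add_zero] at h0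
  obtain ⟨ρ, hρ⟩ := ret _ (hx' none) h0
  choose d hd using fun j => Ideal.Quotient.mk_surjective (ρ (x' (some j)))
  refine ⟨fun j => d j • y, fun j => Submodule.smul_mem _ _ (Submodule.mem_span_singleton_self y),
    fun i => ?_⟩
  have h1 := congrArg ρ (hxa (some i))
  simp only [Fintype.sum_option, Option.elim, map_add, map_sum, map_smul, hρ, ← hd, map_zero] at h1
  have h2 : (Ideal.Quotient.mk (Ideal.span {s})) (-k i + ∑ j, a i j * d j) = 0 := by
    rw [← h1, map_add, map_sum, Algebra.smul_def, mul_one]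
    rfl
  rw [Ideal.Quotient.eq_zero_iff_mem, Ideal.mem_span_singleton] at h2
  obtain ⟨t, ht⟩ := h2
  have h3 : ∑ j, a i j * d j = k i + t * s := by linear_combination ht
  rw [← hk i]
  simp only [smul_smul]
  rw [← Finset.sum_smul, h3, add_smul, mul_smul, hsy, smul_zero, add_zero]

theorem pureSub_sup {N : Submodule R M} (hN : PureSub N) (y : M)
    (hy : PureSub (Submodule.span R {N.mkQ y})) : PureSub (N ⊔ Submodule.span R {y}) := by
  intro ι κ _ _ a x hx
  have hle : N ⊔ Submodule.span R {y} ≤ (Submodule.span R {N.mkQ y}).comap N.mkQ := by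
    refine sup_le (fun n hn => ?_) ?_
    · have h0 : N.mkQ n = 0 := (Submodule.Quotient.mk_eq_zero N).2 hn
      rw [Submodule.mem_comap, h0]
      exact zero_mem _
    · rw [Submodule.span_le, Set.singleton_subset_iff]
      exact Submodule.mem_span_singleton_self _
  obtain ⟨u, hu, hua⟩ := hy ι κ a (fun j => N.mkQ (x j)) (fun i => by
    simpa only [Submodule.mem_comap, map_sum, map_smul] using hle (hx i))
  choose d hd using fun j => Submodule.mem_span_singleton.1 (hu j)
  obtain ⟨n, hn, hna⟩ := hN ι κ a (fun j => x j - d j • y) (fun i => by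
    rw [← Submodule.Quotient.mk_eq_zero, ← Submodule.mkQ_apply]
    simp only [map_sum, map_smul, map_sub, hd, smul_sub, Finset.sum_sub_distrib, hua, sub_self])
  refine ⟨fun j => n j + d j • y, fun j => ?_, fun i => ?_⟩
  · exact add_mem (Submodule.mem_sup_left (hn j)) (Submodule.mem_sup_right
      (Submodule.smul_mem _ _ (Submodule.mem_span_singleton_self y)))
  · simp only [smul_add, Finset.sum_add_distrib, hna, smul_sub, Finset.sum_sub_distrib,
      sub_add_cancel]

end Pure

/-! ### The Zorn argument -/

theorem rdProjective_of_sysLift {R : Type u} [CommRing R] (wf : WellFounded (SDvd (R := R)))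
    {M : Type u} [AddCommGroup M] [Module R M]
    {ι : Type u} (r : ι → R) (q : (⨁ i, R ⧸ Ideal.span {r i}) →ₗ[R] M) (hq : SysLift q) :
    RDProjectiveC R M := by
  intro L Q _ _ _ _ p hp hrd g
  let S : Set (M →ₗ.[R] L) := {h | PureSub h.domain ∧ ∀ x : h.domain, p (h x) = g x}
  obtain ⟨h, hmax⟩ : ∃ h, Maximal (· ∈ S) h := by
    refine zorn_le_nonempty₀ S ?_ ⊥ ?_ |>.imp fun h hh => hh.2
    · intro c hcS hc f0 hf0
      have hdir : DirectedOn (· ≤ ·) c := hc.directedOn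
      refine ⟨LinearPMap.sSup c hdir, ⟨?_, ?_⟩, fun z hz => LinearPMap.le_sSup hdir hz⟩
      · intro I J _ _ a x hx
        have hfin : ∀ T : Finset I, ∃ f ∈ c, ∀ i ∈ T, ∑ j, a i j • x j ∈ f.domain := by
          classical
          intro T
          induction T using Finset.induction_on with
          | empty => exact ⟨f0, hf0, by simp⟩
          | insert i T _ ih =>
            obtain ⟨f, hf, hfT⟩ := ih
            obtain ⟨f', hf', hfi⟩ := (LinearPMap.mem_domain_sSup_iff ⟨f0, hf0⟩ hdir).1 (hx i)
            obtain ⟨f'', hf'', h1, h2⟩ := hdir f hf f' hf'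
            refine ⟨f'', hf'', fun k hk => ?_⟩
            rcases Finset.mem_insert.1 hk with rfl | hk
            · exact h2.1 hfi
            · exact h1.1 (hfT k hk)
        obtain ⟨f, hf, hfx⟩ := hfin Finset.univ
        obtain ⟨y, hy, hya⟩ := (hcS hf).1 I J a x (fun i => hfx i (Finset.mem_univ i))
        exact ⟨y, fun j => (LinearPMap.le_sSup hdir hf).1 (hy j), hya⟩
      · rintro ⟨x, hx⟩
        obtain ⟨f, hf, hfx⟩ := (LinearPMap.mem_domain_sSup_iff ⟨f0, hf0⟩ hdir).1 hx
        have := LinearPMap.sSup_apply hdir hf ⟨x, hfx⟩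
        rw [this]
        exact (hcS hf).2 ⟨x, hfx⟩
    · refine ⟨?_, ?_⟩
      · intro I J _ _ a x hx
        refine ⟨fun _ => 0, fun _ => zero_mem _, fun i => ?_⟩
        have := (Submodule.mem_bot R).1 (hx i)
        rw [this]
        simp
      · rintro ⟨x, hx⟩
        have := (Submodule.mem_bot R).1 hx
        subst this
        have h0 : (⟨0, hx⟩ : (⊥ : M →ₗ.[R] L).domain) = 0 := rfl
        rw [h0, LinearPMap.map_zero, map_zero, ZeroMemClass.coe_zero, map_zero]
  obtain ⟨⟨hpure, hpg⟩, hmax⟩ := hmax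
  have htop : h.domain = ⊤ := by
    by_contra hne
    have hnt : Nontrivial (M ⧸ h.domain) := Submodule.Quotient.nontrivial_iff.2 hne
    obtain ⟨s, yb, hyb0, hsy, hinj, hyp⟩ := exists_pure_cyclic wf r (h.domain.mkQ.comp q)
      ((sysLift_mkQ hpure).comp hq)
    obtain ⟨x, hx, hxa⟩ := sysLift_mkQ hpure Unit Unit (fun _ _ => s) (fun _ => yb)
      (fun _ => by simpa using hsy)
    obtain ⟨y, rfl⟩ : ∃ y, y = x () := ⟨_, rfl⟩
    have hx : h.domain.mkQ (x ()) = yb := hx ()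
    have hxa : s • x () = 0 := by simpa using hxa ()
    generalize x () = y at hx hxa
    subst hx
    -- lift of `g y`
    obtain ⟨l0, hl0⟩ := hp (g y)
    obtain ⟨z, hz, hz'⟩ := hrd s (s • l0) (by rw [map_smul, hl0, ← map_smul, hxa, map_zero])
      ⟨l0, rfl⟩
    have hl : p (l0 - z) = g y := by rw [map_sub, hl0, hz, sub_zero]
    have hsl : s • (l0 - z) = 0 := by rw [smul_sub, hz', sub_self]
    generalize l0 - z = l at hl hsl
    have hH : ∀ c : R, h.domain.mkQ (c • y) = 0 → c • y = 0 ∧ c • l = 0 := by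
      intro c hc
      rw [map_smul] at hc
      obtain ⟨d, rfl⟩ := hinj c hc
      rw [mul_comm, mul_smul, mul_smul, hxa, hsl, smul_zero, smul_zero]
      exact ⟨rfl, rfl⟩
    let k : M →ₗ.[R] L := LinearPMap.mkSpanSingleton' y l (fun c hc =>
      (hH c (by rw [hc, map_zero])).2)
    have hk : ∀ c hc, k ⟨c • y, hc⟩ = c • l := fun c hc =>
      LinearPMap.mkSpanSingleton'_apply y l _ c hc
    have hkd : k.domain = Submodule.span R {y} := rfl
    have hcompat : ∀ (x : h.domain) (w : k.domain), (x : M) = w → h x = k w := by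
      rintro ⟨x, hx⟩ ⟨w, hw⟩ (rfl : x = w)
      obtain ⟨c, rfl⟩ := Submodule.mem_span_singleton.1 hw
      rw [hk]
      have := hH c ((Submodule.Quotient.mk_eq_zero _).2 hx)
      rw [this.2]
      have h0 : (⟨c • y, hx⟩ : h.domain) = 0 := Subtype.ext this.1
      rw [h0, LinearPMap.map_zero]
    have hS : h.sup k hcompat ∈ S := by
      refine ⟨?_, ?_⟩
      · exact pureSub_sup hpure y hyp
      · rintro ⟨x, hx⟩
        obtain ⟨n, hn, w, hw, rfl⟩ := Submodule.mem_sup.1 hx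
        refine (congrArg p (LinearPMap.sup_apply hcompat ⟨n, hn⟩ ⟨w, hw⟩ ⟨n + w, hx⟩ rfl)).trans ?_
        rw [map_add, hpg]
        obtain ⟨c, rfl⟩ := Submodule.mem_span_singleton.1 hw
        rw [hk, map_smul, hl, ← map_smul, ← map_add]
    have hle := (hmax hS (LinearPMap.left_le_sup _ _ _)).1
    apply hyb0
    rw [Submodule.mkQ_apply, Submodule.Quotient.mk_eq_zero]
    exact hle (Submodule.mem_sup_right (Submodule.mem_span_singleton_self y))
  refine ⟨h.toFun.comp (LinearMap.codRestrict h.domain LinearMap.id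
    (fun x => by rw [htop]; trivial)), ?_⟩
  ext x
  exact hpg ⟨x, _⟩

end RDAux

namespace RDAux

open DirectSum

/-! ### The canonical RD-exact presentation -/

section Canon

variable {R : Type u} [CommRing R]

/-- The map from a cyclically presented module given by an element killed by `r`. -/
def liftCyc {M : Type u} [AddCommGroup M] [Module R M] {r : R} {z : M} (h : r • z = 0) :
    (R ⧸ Ideal.span {r}) →ₗ[R] M :=
  Submodule.liftQ (Ideal.span {r}) (LinearMap.toSpanSingleton R M z) (by
    rw [Ideal.span_le, Set.singleton_subset_iff]
    exact h)

theorem liftCyc_mk {M : Type u} [AddCommGroup M] [Module R M] {r : R} {z : M} (h : r • z = 0)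
    (c : R) : liftCyc h (Ideal.Quotient.mk _ c) = c • z := rfl

theorem liftCyc_one {M : Type u} [AddCommGroup M] [Module R M] {r : R} {z : M} (h : r • z = 0) :
    liftCyc h 1 = z := by
  have := liftCyc_mk h 1
  rwa [one_smul, map_one] at this

variable (R) (M : Type u) [AddCommGroup M] [Module R M]

/-- index set -/
abbrev CI : Type u := {rz : R × M // rz.1 • rz.2 = 0}

/-- the canonical direct sum -/
abbrev CG : Type u := ⨁ i : CI R M, R ⧸ Ideal.span {i.1.1}

open Classical in
/-- the canonical map -/
noncomputable def cq : CG R M →ₗ[R] M :=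
  DirectSum.toModule R (CI R M) M (fun i => liftCyc i.2)

open Classical in
/-- the canonical generators -/
noncomputable def cg (i : CI R M) : CG R M :=
  DirectSum.lof R (CI R M) (fun i => R ⧸ Ideal.span {i.1.1}) i 1

theorem cq_cg (i : CI R M) : cq R M (cg R M i) = i.1.2 := by
  classical
  unfold cq cg
  rw [DirectSum.toModule_lof, liftCyc_one]

theorem smul_cg (i : CI R M) : i.1.1 • cg R M i = 0 := by
  classical
  unfold cg
  have : i.1.1 • (1 : R ⧸ Ideal.span {i.1.1}) = 0 := by
    rw [Algebra.smul_def, mul_one]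
    exact Ideal.Quotient.eq_zero_iff_mem.2 (Ideal.mem_span_singleton_self _)
  rw [← map_smul, this, map_zero]

theorem cq_surjective : Function.Surjective (cq R M) := fun m =>
  ⟨cg R M ⟨(0, m), zero_smul R m⟩, cq_cg R M _⟩

theorem cq_rd (r : R) (h : LinearMap.ker (cq R M)) (y : CG R M) (hy : (h : CG R M) = r • y) :
    ∃ h' : LinearMap.ker (cq R M), h = r • h' := by
  have h0 : r • cq R M y = 0 := by
    rw [← map_smul, ← hy]; exact h.2
  let i : CI R M := ⟨(r, cq R M y), h0⟩
  refine ⟨⟨y - cg R M i, ?_⟩, Subtype.ext ?_⟩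
  · rw [LinearMap.mem_ker, map_sub, cq_cg, sub_self]
  · have := smul_cg R M i
    rw [Submodule.coe_smul, smul_sub, hy]
    rw [show r • cg R M i = 0 from this, sub_zero]

variable {R M}

theorem char_extend {P : Type u} [AddCommGroup P] [Module R P] (K : Submodule R P)
    (hK : ∀ (r : R) (k : K) (y : P), (k : P) = r • y → ∃ k' : K, k = r • k')
    (r : R) (ψ : CharacterModule K) (hψ : r • ψ = 0) :
    ∃ φ : CharacterModule P, r • φ = 0 ∧ CharacterModule.dual K.subtype φ = ψ := by
  let rP : Submodule R P := LinearMap.range (LinearMap.lsmul R P r)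
  let u : K →ₗ[R] P ⧸ rP := rP.mkQ.comp K.subtype
  have hker : ∀ k ∈ LinearMap.ker u, ψ k = 0 := by
    intro k hk
    have : (k : P) ∈ rP := (Submodule.Quotient.mk_eq_zero rP).1 hk
    obtain ⟨y, hy⟩ := this
    obtain ⟨k', rfl⟩ := hK r k y hy.symm
    rw [← CharacterModule.smul_apply, hψ]
    rfl
  let ψb : CharacterModule (K ⧸ LinearMap.ker u) :=
    QuotientAddGroup.lift (LinearMap.ker u).toAddSubgroup ψ hker
  let f : (K ⧸ LinearMap.ker u) →ₗ[R] P ⧸ rP := (LinearMap.ker u).liftQ u le_rfl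
  have hf : Function.Injective f := LinearMap.ker_eq_bot.1 (Submodule.ker_liftQ_eq_bot _ _ _ le_rfl)
  obtain ⟨φb, hφb⟩ := CharacterModule.dual_surjective_of_injective f hf ψb
  refine ⟨CharacterModule.dual rP.mkQ φb, ?_, ?_⟩
  · ext p
    rw [CharacterModule.smul_apply, CharacterModule.dual_apply]
    show φb (rP.mkQ (r • p)) = 0
    have : rP.mkQ (r • p) = 0 := (Submodule.Quotient.mk_eq_zero rP).2 ⟨p, rfl⟩
    rw [this, map_zero]
  · ext k
    have := DFunLike.congr_fun hφb ((LinearMap.ker u).mkQ k)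
    exact this

theorem exists_char {ι κ : Type} [Fintype ι] [Fintype κ] (a : ι → κ → R)
    {K : Type u} [AddCommGroup K] [Module R K] (kv : ι → K)
    (hnot : ¬ ∃ y : κ → K, ∀ i, ∑ j, a i j • y j = kv i) :
    ∃ (X : Type u) (_ : AddCommGroup X) (_ : Module R X) (ε : ι → X)
      (χ : X →ₗ[R] CharacterModule K),
      (∀ j, ∑ i, a i j • ε i = 0) ∧ ∑ i, χ (ε i) (kv i) ≠ 0 := by
  classical
  let T : (κ → K) →ₗ[R] (ι → K) := LinearMap.pi fun i => ∑ j, a i j • LinearMap.proj j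
  have hT : ∀ y i, T y i = ∑ j, a i j • y j := fun y i => by
    simp [T, LinearMap.sum_apply]
  have hne : (LinearMap.range T).mkQ kv ≠ 0 := by
    intro h
    obtain ⟨y, hy⟩ := (Submodule.Quotient.mk_eq_zero _).1 h
    exact hnot ⟨y, fun i => by rw [← hT, hy]⟩
  obtain ⟨chz, hzeroth⟩ := CharacterModule.exists_character_apply_ne_zero_of_ne_zero hne
  obtain ⟨chi, hchar, hnonzero⟩ : ∃ chi : CharacterModule (ι → K), (∀ y, chi (T y) = 0) ∧
      chi kv ≠ 0 := by
    refine ⟨CharacterModule.dual (LinearMap.range T).mkQ chz, fun y => ?_, hzeroth⟩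
    show chz ((LinearMap.range T).mkQ (T y)) = 0
    rw [show (LinearMap.range T).mkQ (T y) = 0 from
      (Submodule.Quotient.mk_eq_zero _).2 ⟨y, rfl⟩, map_zero]
  let C : (κ → R) →ₗ[R] (ι → R) := LinearMap.pi fun i => ∑ j, a i j • LinearMap.proj j
  have hC : ∀ y i, C y i = ∑ j, a i j * y j := fun y i => by
    simp [C, LinearMap.sum_apply]
  let chib : (ι → R) →ₗ[R] CharacterModule K :=
    { toFun := fun w => AddMonoidHom.mk' (fun k : K => chi (fun i => w i • k)) (fun k k' => by
        rw [← map_add]; congr 1; funext i; exact smul_add _ _ _)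
      map_add' := fun w w' => by
        ext k
        show chi _ = chi _ + chi _
        rw [← map_add]; congr 1; funext i; exact add_smul _ _ _
      map_smul' := fun c w => by
        ext k
        show chi _ = chi _
        congr 1; funext i
        show (c * w i) • k = w i • c • k
        rw [mul_comm, mul_smul] }
  have hchib : ∀ w k, chib w k = chi (fun i => w i • k) := fun _ _ => rfl
  have hle : LinearMap.range C ≤ LinearMap.ker chib := by
    rintro _ ⟨c, rfl⟩
    rw [LinearMap.mem_ker]
    ext k
    rw [hchib]
    have : (fun i => C c i • k) = T (fun j => c j • k) := by
      funext i
      rw [hT, hC, Finset.sum_smul]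
      exact Finset.sum_congr rfl fun j _ => mul_smul _ _ _
    rw [this, hchar]
    rfl
  refine ⟨(ι → R) ⧸ LinearMap.range C, inferInstance, inferInstance,
    fun i => (LinearMap.range C).mkQ (Pi.single i 1), (LinearMap.range C).liftQ chib hle, ?_, ?_⟩
  · intro j
    rw [← Finset.sum_congr rfl (fun i _ => map_smul _ _ _), ← map_sum]
    refine (Submodule.Quotient.mk_eq_zero _).2 ⟨Pi.single j 1, ?_⟩
    funext i
    rw [hC]
    simp [Finset.sum_apply, Pi.single_apply]
  · have hR : ∀ i, ((LinearMap.range C).liftQ chib hle) ((LinearMap.range C).mkQ (Pi.single i 1))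
        (kv i) = chi (Pi.single i (kv i)) := by
      intro i
      rw [Submodule.mkQ_apply, Submodule.liftQ_apply, hchib]
      congr 1
      funext i'
      by_cases h : i' = i
      · subst h; simp
      · simp [h]
    rw [Finset.sum_congr rfl fun i _ => hR i, ← map_sum, Finset.univ_sum_single kv]
    exact hnonzero

theorem exists_beta {P : Type u} [AddCommGroup P] [Module R P] (K : Submodule R P)
    (hK : ∀ (r : R) (k : K) (y : P), (k : P) = r • y → ∃ k' : K, k = r • k')
    {X : Type u} [AddCommGroup X] [Module R X] (χ : X →ₗ[R] CharacterModule K) :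
    ∃ β : CG R X →ₗ[R] CharacterModule P, ∀ (g : CG R X) (k : K), β g k = χ (cq R X g) k := by
  classical
  choose φ hφ0 hφ using fun i : CI R X => char_extend K hK i.1.1 (χ i.1.2)
    (by rw [← map_smul, i.2, map_zero])
  let β : CG R X →ₗ[R] CharacterModule P :=
    DirectSum.toModule R (CI R X) _ (fun i => liftCyc (hφ0 i))
  have h1 : ∀ i, β (cg R X i) = φ i := by
    intro i
    simp only [β, cg]
    rw [DirectSum.toModule_lof, liftCyc_one]
  have hcomm : (CharacterModule.dual K.subtype).comp β = χ.comp (cq R X) := by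
    apply DirectSum.linearMap_ext
    intro i
    apply Submodule.linearMap_qext
    apply LinearMap.ext_ring
    have h2 : CharacterModule.dual K.subtype (β (cg R X i)) = χ (cq R X (cg R X i)) := by
      rw [h1, hφ, cq_cg]
    exact h2
  exact ⟨β, fun g k => DFunLike.congr_fun (LinearMap.congr_fun hcomm g) k⟩

theorem rdFlat_sum_eq_zero (hM : RDFlatC R M) {ι κ : Type} [Fintype ι] [Fintype κ]
    (a : ι → κ → R) (x : κ → M) (hx : ∀ i, ∑ j, a i j • x j = 0)
    {G : Type u} [AddCommGroup G] [Module R G] (Y : Submodule R G)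
    (hY : ∀ (r : R) (k : Y) (y : G), (k : G) = r • y → ∃ k' : Y, k = r • k')
    (g : ι → G) (hg : ∀ j, ∑ i, a i j • g i ∈ Y)
    {P : Type u} [AddCommGroup P] [Module R P] (q : P →ₗ[R] M) (σ : M → P)
    (hσ : ∀ m, q (σ m) = m) (β : G →ₗ[R] CharacterModule P)
    (hβY : ∀ y ∈ Y, ∀ (p p' : P), q p = q p' → β y p = β y p') :
    ∑ i, β (g i) (∑ j, a i j • σ (x j)) = 0 := by
  have hz := hM Y G Y.subtype Subtype.val_injective hY
    (Finset.univ.toList.map fun j => (x j, ⟨∑ i, a i j • g i, hg j⟩)) (by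
      intro A _ b h1 h2 h3
      let B : M →+ G →+ A := AddMonoidHom.mk' (fun m => AddMonoidHom.mk' (b m) (h2 m))
        (fun m₁ m₂ => by ext n; exact h1 m₁ m₂ n)
      have hB : ∀ (r : R) (m : M) (n : G), B (r • m) n = B m (r • n) := h3
      rw [List.map_map, List.map_map, Finset.sum_map_toList]
      show ∑ j, B (x j) (∑ i, a i j • g i) = 0
      simp only [map_sum, ← hB]
      rw [Finset.sum_comm]
      refine Finset.sum_eq_zero fun i _ => ?_
      rw [← AddMonoidHom.finsetSum_apply, ← map_sum, hx i, map_zero, AddMonoidHom.zero_apply])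
    (ULift.{u} (AddCircle (1 : ℚ))) (fun m y => ULift.up (β y (σ m)))
    (fun m₁ m₂ y => by
      apply ULift.ext
      show β y (σ (m₁ + m₂)) = β y (σ m₁) + β y (σ m₂)
      rw [← map_add]
      exact hβY _ y.2 _ _ (by rw [map_add, hσ, hσ, hσ]))
    (fun m y₁ y₂ => by
      apply ULift.ext
      show β ((y₁ : G) + y₂) (σ m) = β y₁ (σ m) + β y₂ (σ m)
      rw [map_add]; rfl)
    (fun r m y => by
      apply ULift.ext
      show β y (σ (r • m)) = β (r • (y : G)) (σ m)
      rw [map_smul, CharacterModule.smul_apply]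
      exact hβY _ y.2 _ _ (by rw [map_smul, hσ, hσ]))
  rw [List.map_map, Finset.sum_map_toList] at hz
  have hz' : ∑ j, β (∑ i, a i j • g i) (σ (x j)) = 0 := by
    have := congrArg (AddEquiv.ulift (α := AddCircle (1 : ℚ))) hz
    rw [map_sum, map_zero] at this
    exact this
  rw [← hz']
  have hsum : ∀ (s : Finset ι) (f : ι → CharacterModule P) (p : P),
      (∑ i ∈ s, f i) p = ∑ i ∈ s, f i p := fun s f p =>
    map_sum (AddMonoidHom.mk' (fun c : CharacterModule P => c p) (fun _ _ => rfl)) f s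
  have hL : ∀ j, β (∑ i, a i j • g i) (σ (x j)) = ∑ i, β (g i) (a i j • σ (x j)) := by
    intro j
    rw [map_sum, hsum]
    exact Finset.sum_congr rfl fun i _ => by rw [map_smul, CharacterModule.smul_apply]
  rw [Finset.sum_congr rfl fun j _ => hL j, Finset.sum_comm]
  exact Finset.sum_congr rfl fun i _ => map_sum _ _ _

theorem sysLift_of_rdFlat (hM : RDFlatC R M) : SysLift (cq R M) := by
  intro ι κ _ _ a x hx
  choose σ hσ using cq_surjective R M
  have hkv : ∀ i, ∑ j, a i j • σ (x j) ∈ LinearMap.ker (cq R M) := fun i => by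
    rw [LinearMap.mem_ker, map_sum]
    exact (Finset.sum_congr rfl fun j _ => by rw [map_smul, hσ]).trans (hx i)
  by_cases hmem : ∃ y : κ → LinearMap.ker (cq R M), ∀ i, ∑ j, a i j • y j =
      ⟨∑ j, a i j • σ (x j), hkv i⟩
  · obtain ⟨y, hy⟩ := hmem
    refine ⟨fun j => σ (x j) - y j, fun j => ?_, fun i => ?_⟩
    · rw [map_sub, hσ, (y j).2, sub_zero]
    · have := congrArg Subtype.val (hy i)
      simp only [AddSubmonoidClass.coe_finsetSum, Submodule.coe_smul] at this
      simp only [smul_sub, Finset.sum_sub_distrib]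
      rw [this, sub_self]
  exfalso
  obtain ⟨X, _, _, ε, χ, hε, hne⟩ := exists_char a (K := LinearMap.ker (cq R M))
    (fun i => ⟨∑ j, a i j • σ (x j), hkv i⟩) hmem
  obtain ⟨β, hβ⟩ := exists_beta (LinearMap.ker (cq R M)) (cq_rd R M) χ
  choose g hg using fun i : ι => cq_surjective R X (ε i)
  have h0 := rdFlat_sum_eq_zero hM a x hx (LinearMap.ker (cq R X)) (cq_rd R X) g
    (fun j => by
      rw [LinearMap.mem_ker, map_sum]
      exact (Finset.sum_congr rfl fun i _ => by rw [map_smul, hg]).trans (hε j))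
    (cq R M) σ hσ β (by
      intro y hy p p' hpp
      have h1 := hβ y ⟨p - p', by rw [LinearMap.mem_ker, map_sub, hpp, sub_self]⟩
      rw [LinearMap.mem_ker.1 hy, map_zero] at h1
      have h2 : β y (p - p') = 0 := h1
      rw [map_sub, sub_eq_zero] at h2
      exact h2)
  apply hne
  rw [← h0]
  refine Finset.sum_congr rfl fun i _ => ?_
  rw [← hg]
  exact (hβ (g i) ⟨_, hkv i⟩).symm

end Canon

end RDAux


/-- A commutative ring `R` is perfect (every flat `R`-module is projective) if and
only if every RD-flat `R`-module is RD-projective. -/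
theorem perfect_iff_rdFlat_rdProjective (R : Type u) [CommRing R] :
    (∀ (M : Type u) [AddCommGroup M] [Module R M],
      Module.Flat R M → Module.Projective R M) ↔
    (∀ (M : Type u) [AddCommGroup M] [Module R M],
      RDFlatC R M → RDProjectiveC R M) := by
  constructor
  · intro hR M _ _ hM
    exact RDAux.rdProjective_of_sysLift (RDAux.wf_sdvd R hR) _ (RDAux.cq R M)
      (RDAux.sysLift_of_rdFlat hM)
  · intro h M _ _ hM
    exact RDAux.projective_of_flat_of_rdProjective R M (h M (RDAux.rdFlat_of_flat R M))
end

section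
/- Let R be a commutative local ring with maximal ideal P and J = ∩_{n∈ℕ} P^n. Then every artinian R-module is RD-injective if and only if both simple module R/P and R/J are RD-flat, if and only if the set of nonzero principal ideals contained in P is directed and the set of nonzero principal ideals contained in J is directed. -/
universe u

open MulOpposite

open IsLocalRing

section RDHelpers

/-- Relative divisibility of a linear map. -/
def IsRDMap {R : Type u} [CommRing R] {H F : Type u} [AddCommGroup H] [Module R H]
    [AddCommGroup F] [Module R F] (f : H →ₗ[R] F) : Prop :=
  Function.Injective f ∧ ∀ (r : R) (h : H) (y : F), f h = r • y → ∃ h' : H, h = r • h'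

/-- Concrete form of RD-flatness of `R ⧸ I`. -/
lemma rdFlat_quot_iff {R : Type u} [CommRing R] (I : Ideal R) :
    RDFlatC R (R ⧸ I) ↔ ∀ (H F : Type u) [AddCommGroup H] [Module R H] [AddCommGroup F]
      [Module R F] (f : H →ₗ[R] F), IsRDMap f →
      ∀ h : H, f h ∈ I • (⊤ : Submodule R F) → h ∈ I • (⊤ : Submodule R H) := by
  constructor
  · intro hflat H F _ _ _ _ f hf h hh
    have key := hflat H F f hf.1 hf.2 [((1 : R ⧸ I), h)] (by
      intro A _ b b1 b2 b3
      simp only [List.map_cons, List.map_nil, List.sum_cons, List.sum_nil, add_zero]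
      have b0 : ∀ n, b 0 n = 0 := fun n => by simpa using b1 0 0 n
      refine Submodule.smul_induction_on (p := fun x => b 1 x = 0) hh ?_ ?_
      · intro r hr n _
        rw [← b3]
        have : r • (1 : R ⧸ I) = 0 := by
          rw [← map_one (Ideal.Quotient.mk I), ← Ideal.Quotient.mk_eq_mk, ← Submodule.Quotient.mk_smul]
          exact (Submodule.Quotient.mk_eq_zero I).2 (by simpa using hr)
        rw [this, b0]
      · intro x y hx hy
        rw [b2, hx, hy, add_zero])
    have := key (H ⧸ I • (⊤ : Submodule R H)) (fun m n => m • Submodule.Quotient.mk n)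
      (fun m₁ m₂ n => add_smul _ _ _) (fun m n₁ n₂ => by
        rw [Submodule.Quotient.mk_add, smul_add])
      (fun r m n => by rw [Submodule.Quotient.mk_smul, smul_assoc, smul_comm])
    simpa using this
  · intro hI H F _ _ _ _ f hf1 hf2 l hl A _ b b1 b2 b3
    have b0 : ∀ n, b 0 n = 0 := fun n => by simpa using b1 0 0 n
    have b0' : ∀ n, b n 0 = 0 := fun n => by simpa using b2 n 0 0
    have hl' := hl (F ⧸ I • (⊤ : Submodule R F)) (fun m n => m • Submodule.Quotient.mk n)
      (fun m₁ m₂ n => add_smul _ _ _) (fun m n₁ n₂ => by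
        rw [Submodule.Quotient.mk_add, smul_add])
      (fun r m n => by rw [Submodule.Quotient.mk_smul, smul_assoc, smul_comm])
    have ex : ∀ l : List ((R ⧸ I) × H), ∃ h : H,
        ((l.map fun p => b p.1 p.2).sum = b 1 h) ∧
        (((l.map fun p => (p.1, f p.2)).map fun p =>
          p.1 • (Submodule.Quotient.mk p.2 : F ⧸ I • (⊤ : Submodule R F))).sum =
          Submodule.Quotient.mk (f h)) := by
      intro l
      induction l with
      | nil => exact ⟨0, by simp [b0']⟩
      | cons p l ih =>
        obtain ⟨h, h1, h2⟩ := ih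
        obtain ⟨m, n⟩ := p
        obtain ⟨r, rfl⟩ := Ideal.Quotient.mk_surjective m
        refine ⟨r • n + h, ?_, ?_⟩
        · simp only [List.map_cons, List.sum_cons]
          rw [h1, b2, ← b3]
          congr 2
          rw [← map_one (Ideal.Quotient.mk I), ← Ideal.Quotient.mk_eq_mk, ← Ideal.Quotient.mk_eq_mk,
            ← Submodule.Quotient.mk_smul]
          simp
        · simp only [List.map_cons, List.sum_cons]
          rw [h2, map_add, map_smul, Submodule.Quotient.mk_add]
          rfl
    obtain ⟨h, h1, h2⟩ := ex l
    rw [h1]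
    rw [h2, Submodule.Quotient.mk_eq_zero] at hl'
    have := hI H F f ⟨hf1, hf2⟩ h hl'
    refine Submodule.smul_induction_on (p := fun x => b 1 x = 0) this ?_ ?_
    · intro r hr n _
      rw [← b3]
      have : r • (1 : R ⧸ I) = 0 := by
        rw [← map_one (Ideal.Quotient.mk I), ← Ideal.Quotient.mk_eq_mk, ← Submodule.Quotient.mk_smul]
        exact (Submodule.Quotient.mk_eq_zero I).2 (by simpa using hr)
      rw [this, b0]
    · intro x y hx hy
      rw [b2, hx, hy, add_zero]

/-- Directedness in elementwise form. -/
def DirIdeal {R : Type u} [CommRing R] (I : Ideal R) : Prop :=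
  ∀ a ∈ I, ∀ b ∈ I, ∃ c ∈ I, c ∣ a ∧ c ∣ b

lemma dirIdeal_iff {R : Type u} [CommRing R] (I : Ideal R) :
    DirIdeal I ↔ (∀ a b : R, a ≠ 0 → b ≠ 0 →
          Ideal.span {a} ≤ I → Ideal.span {b} ≤ I →
          ∃ c : R, c ≠ 0 ∧ Ideal.span {c} ≤ I ∧
            Ideal.span {a} ≤ Ideal.span {c} ∧ Ideal.span {b} ≤ Ideal.span {c}) := by
  simp only [Ideal.span_singleton_le_iff_mem, Ideal.mem_span_singleton]
  constructor
  · intro h a b ha hb haI hbI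
    obtain ⟨c, hc, h1, h2⟩ := h a haI b hbI
    exact ⟨c, fun h0 => ha (by simpa [h0] using h1), hc, h1, h2⟩
  · intro h a ha b hb
    by_cases a0 : a = 0
    · exact ⟨b, hb, by simp [a0], dvd_rfl⟩
    by_cases b0 : b = 0
    · exact ⟨a, ha, dvd_rfl, by simp [b0]⟩
    obtain ⟨c, -, hc, h1, h2⟩ := h a b a0 b0 ha hb
    exact ⟨c, hc, h1, h2⟩

lemma rdFlat_of_dir {R : Type u} [CommRing R] (I : Ideal R) (hI : DirIdeal I) :
    RDFlatC R (R ⧸ I) := by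
  rw [rdFlat_quot_iff]
  intro H F _ _ _ _ f hf h hh
  have : ∃ c ∈ I, ∃ y, f h = c • y := by
    refine Submodule.smul_induction_on (p := fun x => ∃ c ∈ I, ∃ y, x = c • y) hh ?_ ?_
    · intro r hr n _
      exact ⟨r, hr, n, rfl⟩
    · rintro _ _ ⟨a, ha, x, rfl⟩ ⟨b, hb, y, rfl⟩
      obtain ⟨c, hc, ⟨s, rfl⟩, ⟨t, rfl⟩⟩ := hI a ha b hb
      exact ⟨c, hc, s • x + t • y, by rw [smul_add, smul_smul, smul_smul]⟩
  obtain ⟨c, hc, y, hy⟩ := this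
  obtain ⟨h', rfl⟩ := hf.2 c h y hy
  exact Submodule.smul_mem_smul hc trivial

lemma dir_of_rdFlat {R : Type u} [CommRing R] [IsLocalRing R] (I : Ideal R)
    (hIP : I ≤ maximalIdeal R) (hI : RDFlatC R (R ⧸ I)) : DirIdeal I := by
  classical
  rw [rdFlat_quot_iff] at hI
  intro a ha b hb
  by_cases h0 : ((a, b) : R × R) = 0
  · obtain ⟨rfl, rfl⟩ := Prod.mk.inj h0
    exact ⟨0, I.zero_mem, dvd_rfl, dvd_rfl⟩
  set v0 : R × R := (a, b) with hv0
  let S : Type u := {s : R × (R × R) × R // s.1 • s.2.1 = s.2.2 • v0}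
  let N : Submodule R (S →₀ R) :=
    { carrier := {z | ∀ s : S, s.1.1 ∣ z s}
      add_mem' := fun {x y} hx hy s => by simpa using dvd_add (hx s) (hy s)
      zero_mem' := fun s => by simp
      smul_mem' := fun c x hx s => by simpa using Dvd.dvd.mul_left (hx s) c }
  let Q := (R × R) ⧸ Submodule.span R {v0}
  let σ : (S →₀ R) →ₗ[R] (R × R) := Finsupp.linearCombination R (fun s : S => s.1.2.1)
  let τ : (S →₀ R) →ₗ[R] Q := (Submodule.mkQ _).comp σ
  have hσN : ∀ (z : S →₀ R) (w : S → R), (∀ s, z s = s.1.1 * w s) →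
      σ z = (∑ s ∈ z.support, w s * s.1.2.2) • v0 := by
    intro z w hw
    simp only [σ, Finsupp.linearCombination_apply, Finsupp.sum]
    rw [Finset.sum_smul]
    refine Finset.sum_congr rfl fun s _ => ?_
    rw [hw, mul_comm, mul_smul, s.2, mul_smul]
  have hN : N ≤ LinearMap.ker τ := by
    intro z hz
    choose w hw using hz
    rw [LinearMap.mem_ker, LinearMap.comp_apply, hσN z w hw, Submodule.mkQ_apply,
      Submodule.Quotient.mk_eq_zero]
    exact Submodule.smul_mem _ _ (Submodule.mem_span_singleton_self _)
  let π : ((R × R) × ((S →₀ R) ⧸ N)) →ₗ[R] Q :=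
    LinearMap.coprod (Submodule.mkQ _) (N.liftQ τ hN)
  have hπ : ∀ v z, π (v, Submodule.Quotient.mk z) = Submodule.Quotient.mk (v + σ z) := by
    intro v z
    simp only [π, LinearMap.coprod_apply, Submodule.liftQ_apply]
    rfl
  have hRD : IsRDMap (LinearMap.ker π).subtype := by
    refine ⟨Subtype.val_injective, ?_⟩
    intro r k y hky
    obtain ⟨q, hq⟩ := Submodule.Quotient.mk_surjective _ (π y)
    have hrq : r • π y = 0 := by
      rw [← map_smul, ← hky]; exact k.2
    rw [← hq, ← Submodule.Quotient.mk_smul, Submodule.Quotient.mk_eq_zero,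
      Submodule.mem_span_singleton] at hrq
    obtain ⟨t, ht⟩ := hrq
    let s : S := ⟨(r, q, t), ht.symm⟩
    refine ⟨⟨y - (0, Submodule.Quotient.mk (Finsupp.single s 1)), ?_⟩, ?_⟩
    · rw [LinearMap.mem_ker, map_sub, hπ, ← hq]
      simp [σ, s]
    · apply Subtype.ext
      change (k : (R × R) × ((S →₀ R) ⧸ N)) = r • (y - (0, Submodule.Quotient.mk (Finsupp.single s 1)))
      rw [smul_sub, ← hky]
      have : r • ((0, Submodule.Quotient.mk (Finsupp.single s 1)) : (R × R) × ((S →₀ R) ⧸ N)) = 0 := by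
        rw [Prod.smul_mk, smul_zero, ← Submodule.Quotient.mk_smul]
        refine Prod.ext rfl ?_
        change Submodule.Quotient.mk _ = 0
        rw [Submodule.Quotient.mk_eq_zero]
        intro s'
        by_cases h : s = s'
        · subst h; simp [s]
        · simp [h]
      rw [this, sub_zero]; rfl
  have hk : ((v0, 0) : (R × R) × ((S →₀ R) ⧸ N)) ∈ LinearMap.ker π := by
    have := hπ v0 0
    rw [Submodule.Quotient.mk_zero] at this
    rw [LinearMap.mem_ker, this, Submodule.Quotient.mk_eq_zero, map_zero, add_zero]
    exact Submodule.mem_span_singleton_self _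
  have hmem := hI _ _ _ hRD ⟨(v0, 0), hk⟩ (by
    have : ((v0, 0) : (R × R) × ((S →₀ R) ⧸ N)) = a • ((1, 0), 0) + b • ((0, 1), 0) := by
      simp [hv0]
    change ((v0, 0) : (R × R) × ((S →₀ R) ⧸ N)) ∈ _
    rw [this]
    exact Submodule.add_mem _ (Submodule.smul_mem_smul ha trivial)
      (Submodule.smul_mem_smul hb trivial))
  have key : ∃ (z : S →₀ R) (c : R), c ∈ I ∧ (∀ s, z s ∈ I) ∧
      (v0, 0) = (c • v0 - σ z, (Submodule.Quotient.mk z : (S →₀ R) ⧸ N)) := by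
    refine Submodule.smul_induction_on (p := fun x => ∃ (z : S →₀ R) (c : R), c ∈ I ∧
      (∀ s, z s ∈ I) ∧ x.1 = (c • v0 - σ z, (Submodule.Quotient.mk z : (S →₀ R) ⧸ N))) hmem ?_ ?_
    · rintro i hi ⟨⟨v, z'⟩, hvz⟩ -
      obtain ⟨z, rfl⟩ := Submodule.Quotient.mk_surjective _ z'
      rw [LinearMap.mem_ker, hπ, Submodule.Quotient.mk_eq_zero, Submodule.mem_span_singleton] at hvz
      obtain ⟨c, hc⟩ := hvz
      refine ⟨i • z, i * c, I.mul_mem_right _ hi, fun s => by simpa using I.mul_mem_right _ hi, ?_⟩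
      change i • ((v, Submodule.Quotient.mk z) : (R × R) × ((S →₀ R) ⧸ N)) = _
      rw [mul_smul, hc, map_smul, Submodule.Quotient.mk_smul, ← smul_sub, Prod.smul_mk]
      simp
    · rintro x y ⟨z, c, hc, hz, hx⟩ ⟨z', c', hc', hz', hy⟩
      refine ⟨z + z', c + c', I.add_mem hc hc', fun s => by simpa using I.add_mem (hz s) (hz' s), ?_⟩
      change x.1 + y.1 = _
      rw [hx, hy, Prod.mk_add_mk, Submodule.Quotient.mk_add, map_add, add_smul]
      congr 1
      abel
  obtain ⟨z, c, hc, hz, he⟩ := key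
  obtain ⟨he1, he2⟩ := Prod.mk.inj he
  have hzN : z ∈ N := (Submodule.Quotient.mk_eq_zero N).1 he2.symm
  have hzN' : ∀ s : S, s.1.1 ∣ z s := hzN
  choose w hw using hzN'
  rw [hσN z w hw] at he1
  set T := ∑ s ∈ z.support, w s * s.1.2.2 with hT
  have hzero : (1 - c + T) • v0 = 0 := by
    rw [add_smul, sub_smul, one_smul]
    nth_rewrite 1 [he1]
    abel
  have hTu : T ∉ maximalIdeal R := by
    intro hTP
    have hu : IsUnit (1 - c + T) := by
      by_contra hnu
      have h1 : (1 - c + T) ∈ maximalIdeal R := (mem_maximalIdeal _).2 hnu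
      have h2 : (1 : R) ∈ maximalIdeal R := by
        have := Ideal.sub_mem _ (Ideal.add_mem _ h1 (hIP hc)) hTP
        rwa [show 1 - c + T + c - T = 1 by ring] at this
      exact (Ideal.ne_top_iff_one _).1 (maximalIdeal.isMaximal R).ne_top h2
    exact h0 ((hu.smul_eq_zero).1 hzero)
  have : ∃ s : S, w s * s.1.2.2 ∉ maximalIdeal R := by
    by_contra hcon
    push Not at hcon
    exact hTu (Ideal.sum_mem _ fun s _ => hcon s)
  obtain ⟨s, hs⟩ := this
  rw [mem_maximalIdeal, mem_nonunits_iff, not_not, IsUnit.mul_iff] at hs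
  obtain ⟨hwu, htu⟩ := hs
  refine ⟨s.1.1, ?_, ?_, ?_⟩
  · have := hz s
    rw [hw] at this
    exact (Ideal.mul_unit_mem_iff_mem I hwu).1 this
  · have := congrArg Prod.fst s.2
    simp only [Prod.smul_fst, smul_eq_mul, hv0] at this
    exact (htu.dvd_mul_left).1 ⟨_, this.symm⟩
  · have := congrArg Prod.snd s.2
    simp only [Prod.smul_snd, smul_eq_mul, hv0] at this
    exact (htu.dvd_mul_left).1 ⟨_, this.symm⟩

/-- Relative form of divisibility over `R ⧸ I`. -/
def DivOver {R : Type u} [CommRing R] (I : Ideal R) (M : Type u) [AddCommGroup M]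
    [Module R M] : Prop :=
  (∀ i ∈ I, ∀ m : M, i • m = 0) ∧
  ∀ K : Ideal R, I ≤ K → K ≠ I → ∃ d ∈ K, K ≤ I ⊔ Ideal.span {d} ∧ ∀ m : M, ∃ m', m = d • m'

lemma injective_of_divOver {R : Type u} [CommRing R] (I : Ideal R) (M : Type u) [AddCommGroup M]
    [Module R M] [Module (R ⧸ I) M] [IsScalarTower R (R ⧸ I) M] (hM : DivOver I M) :
    Module.Injective (R ⧸ I) M := by
  apply Module.Baer.injective
  intro K g
  have hmk : ∀ (r : R) (m : M), (Ideal.Quotient.mk I r) • m = r • m := by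
    intro r m
    have : Ideal.Quotient.mk I r = r • (1 : R ⧸ I) := by
      rw [Algebra.smul_def, mul_one]; rfl
    rw [this, smul_assoc, one_smul]
  by_cases hK : K = ⊥
  · subst hK
    refine ⟨0, fun x hx => ?_⟩
    have : (⟨x, hx⟩ : (⊥ : Ideal (R ⧸ I))) = 0 := Subtype.ext (by simpa using hx)
    rw [this]; simp
  · have hIK : I ≤ K.comap (Ideal.Quotient.mk I) := by
      intro i hi
      rw [Ideal.mem_comap, Ideal.Quotient.eq_zero_iff_mem.2 hi]
      exact K.zero_mem
    obtain ⟨d, hd, hdK, hdiv⟩ := hM.2 _ hIK (by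
      intro he
      apply hK
      rw [eq_bot_iff]
      intro x hx
      obtain ⟨r, rfl⟩ := Ideal.Quotient.mk_surjective x
      have : r ∈ K.comap (Ideal.Quotient.mk I) := hx
      rw [he] at this
      simpa using Ideal.Quotient.eq_zero_iff_mem.2 this)
    obtain ⟨m', hm'⟩ := hdiv (g ⟨Ideal.Quotient.mk I d, hd⟩)
    refine ⟨LinearMap.toSpanSingleton _ _ m', fun x hx => ?_⟩
    obtain ⟨r, rfl⟩ := Ideal.Quotient.mk_surjective x
    have hr : r ∈ K.comap (Ideal.Quotient.mk I) := hx
    obtain ⟨i, hi, y, hy, rfl⟩ := Submodule.mem_sup.1 (hdK hr)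
    obtain ⟨t, rfl⟩ := Ideal.mem_span_singleton'.1 hy
    have e : (⟨Ideal.Quotient.mk I (i + t * d), hx⟩ : K) =
        (Ideal.Quotient.mk I t) • ⟨Ideal.Quotient.mk I d, hd⟩ := by
      apply Subtype.ext
      simp [Ideal.Quotient.eq_zero_iff_mem.2 hi]
    rw [e, map_smul, hm', LinearMap.toSpanSingleton_apply, hmk, hmk, add_smul, hM.1 i hi, zero_add,
      mul_smul]

lemma ext_of_divOver {R : Type u} [CommRing R] (I : Ideal R) (M : Type u) [AddCommGroup M]
    [Module R M] (hM : DivOver I M) {H F : Type u} [AddCommGroup H] [Module R H]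
    [AddCommGroup F] [Module R F] (f : H →ₗ[R] F)
    (hf : ∀ h : H, f h ∈ I • (⊤ : Submodule R F) → h ∈ I • (⊤ : Submodule R H))
    (g : H →ₗ[R] M) : ∃ k : F →ₗ[R] M, k.comp f = g := by
  have htor : Module.IsTorsionBySet R M I := fun m i => hM.1 i i.2 m
  let := htor.module
  have : IsScalarTower R (R ⧸ I) M := htor.isScalarTower
  have hinj := injective_of_divOver I M hM
  have hs : Function.Surjective (algebraMap R (R ⧸ I)) := Ideal.Quotient.mk_surjective
  have hle : I • (⊤ : Submodule R H) ≤ (I • (⊤ : Submodule R F)).comap f := by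
    rw [Submodule.smul_le]
    intro r hr n _
    rw [Submodule.mem_comap, map_smul]
    exact Submodule.smul_mem_smul hr trivial
  have hlg : I • (⊤ : Submodule R H) ≤ LinearMap.ker g := by
    rw [Submodule.smul_le]
    intro r hr n _
    rw [LinearMap.mem_ker, map_smul, hM.1 r hr]
  let f1 := LinearMap.extendScalarsOfSurjective hs (Submodule.mapQ _ _ f hle)
  let g1 := LinearMap.extendScalarsOfSurjective hs (Submodule.liftQ _ g hlg)
  obtain ⟨k, hk⟩ := hinj.out f1 (by
    rw [injective_iff_map_eq_zero]
    intro x hx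
    obtain ⟨x, rfl⟩ := Submodule.Quotient.mk_surjective _ x
    rw [Submodule.Quotient.mk_eq_zero]
    exact hf x ((Submodule.Quotient.mk_eq_zero _).1 hx)) g1
  refine ⟨(k.restrictScalars R).comp (Submodule.mkQ _), ?_⟩
  ext x
  exact hk (Submodule.Quotient.mk x)

/-- An RD-injective relatively divisible module with a socle element detects RD-flatness. -/
lemma rdFlat_of_cogen {R : Type u} [CommRing R] [IsLocalRing R] (I : Ideal R) (M : Type u)
    [AddCommGroup M] [Module R M] (hM : DivOver I M) (m : M) (hm : m ≠ 0)
    (hPm : ∀ r ∈ maximalIdeal R, r • m = 0) (hRD : RDInjectiveC R M) : RDFlatC R (R ⧸ I) := by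
  rw [rdFlat_quot_iff]
  intro H F _ _ _ _ f hf h hh
  by_contra hcon
  let x : H ⧸ I • (⊤ : Submodule R H) := Submodule.Quotient.mk h
  have hx : x ≠ 0 := fun h0 => hcon ((Submodule.Quotient.mk_eq_zero _).1 h0)
  let φ := LinearMap.toSpanSingleton R _ x
  have hker : LinearMap.ker φ ≤ LinearMap.ker (LinearMap.toSpanSingleton R M m) := by
    intro r hr
    rw [LinearMap.mem_ker, LinearMap.toSpanSingleton_apply] at hr ⊢
    apply hPm
    rw [mem_maximalIdeal]
    intro hu
    exact hx ((hu.smul_eq_zero).1 hr)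
  have hx0 : ∀ i ∈ I, ∀ y : H ⧸ I • (⊤ : Submodule R H), i • y = 0 := by
    intro i hi y
    obtain ⟨y, rfl⟩ := Submodule.Quotient.mk_surjective _ y
    rw [← Submodule.Quotient.mk_smul, Submodule.Quotient.mk_eq_zero]
    exact Submodule.smul_mem_smul hi trivial
  obtain ⟨k, hk⟩ := ext_of_divOver I M hM ((LinearMap.ker φ).liftQ φ le_rfl) (by
    intro y hy
    have : (I • (⊤ : Submodule R (H ⧸ I • (⊤ : Submodule R H)))) = ⊥ := by
      rw [eq_bot_iff, Submodule.smul_le]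
      intro r hr n _
      simpa using hx0 r hr n
    rw [this, Submodule.mem_bot] at hy
    have : y = 0 := by
      have hi : Function.Injective ((LinearMap.ker φ).liftQ φ le_rfl) := by
        rw [← LinearMap.ker_eq_bot]
        exact Submodule.ker_liftQ_eq_bot _ _ _ le_rfl
      exact hi (by rw [hy, map_zero])
    rw [this]; exact Submodule.zero_mem _) ((LinearMap.ker φ).liftQ _ hker)
  have hkx : k x = m := by
    have := LinearMap.congr_fun hk (Submodule.Quotient.mk 1)
    rw [LinearMap.comp_apply, Submodule.liftQ_apply, Submodule.liftQ_apply] at this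
    simpa [φ] using this
  obtain ⟨l, hl⟩ := hRD H F f hf.1 hf.2 (k.comp (Submodule.mkQ _))
  have h1 : l (f h) = m := by
    rw [← hkx]; exact LinearMap.congr_fun hl h
  apply hm
  rw [← h1]
  refine Submodule.smul_induction_on (p := fun y => l y = 0) hh ?_ ?_
  · intro r hr n _
    rw [map_smul, hM.1 r hr]
  · intro y z hy hz
    rw [map_add, hy, hz, add_zero]

lemma pow_or {R : Type u} [CommRing R] [IsLocalRing R] {p : R}
    (hp : maximalIdeal R = Ideal.span {p}) (r : R) (m : ℕ) :
    p ^ m ∣ r ∨ ∃ j < m, ∃ v : R, IsUnit v ∧ r = v * p ^ j := by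
  induction m with
  | zero => left; simp
  | succ m ih =>
    rcases ih with ⟨t, rfl⟩ | ⟨j, hj, v, hv, rfl⟩
    · by_cases ht : IsUnit t
      · exact Or.inr ⟨m, Nat.lt_succ_self m, t, ht, mul_comm _ _⟩
      · left
        have : t ∈ maximalIdeal R := (mem_maximalIdeal _).2 ht
        rw [hp, Ideal.mem_span_singleton] at this
        rw [pow_succ]
        exact mul_dvd_mul_left _ this
    · exact Or.inr ⟨j, by omega, v, hv, rfl⟩

lemma mem_J_iff {R : Type u} [CommRing R] [IsLocalRing R] {p : R}
    (hp : maximalIdeal R = Ideal.span {p}) (r : R) :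
    r ∈ (⨅ n : ℕ, maximalIdeal R ^ n) ↔ ∀ n : ℕ, p ^ n ∣ r := by
  simp only [Ideal.mem_iInf, hp, Ideal.span_singleton_pow, Ideal.mem_span_singleton]

lemma divOver_J {R : Type u} [CommRing R] [IsLocalRing R] {p : R}
    (hp : maximalIdeal R = Ideal.span {p}) (M : Type u) [AddCommGroup M] [Module R M]
    (hJ : ∀ i ∈ (⨅ n : ℕ, maximalIdeal R ^ n), ∀ m : M, i • m = 0)
    (hdiv : ∀ m : M, ∃ m', m = p • m') : DivOver (⨅ n : ℕ, maximalIdeal R ^ n) M := by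
  classical
  refine ⟨hJ, fun K hJK hne => ?_⟩
  have hdivn : ∀ (n : ℕ) (m : M), ∃ m', m = p ^ n • m' := by
    intro n
    induction n with
    | zero => exact fun m => ⟨m, by simp⟩
    | succ n ih =>
      intro m
      obtain ⟨m', rfl⟩ := ih m
      obtain ⟨m'', rfl⟩ := hdiv m'
      exact ⟨m'', by rw [pow_succ, mul_smul]⟩
  have hmemK : ∀ (v : R) (j : ℕ), IsUnit v → v * p ^ j ∈ K → p ^ j ∈ K := fun v j hv h =>
    (Ideal.unit_mul_mem_iff_mem K hv).1 h
  have hex : ∃ n, p ^ n ∈ K := by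
    by_contra hcon
    push Not at hcon
    apply hne
    refine le_antisymm (fun r hr => ?_) hJK
    rw [mem_J_iff hp]
    intro n
    rcases pow_or hp r n with h | ⟨j, -, v, hv, rfl⟩
    · exact h
    · exact absurd (hmemK v j hv hr) (hcon j)
  refine ⟨p ^ Nat.find hex, Nat.find_spec hex, fun r hr => ?_, hdivn _⟩
  rcases pow_or hp r (Nat.find hex) with h | ⟨j, hj, v, hv, rfl⟩
  · exact Submodule.mem_sup_right (Ideal.mem_span_singleton.2 h)
  · exact absurd (hmemK v j hv hr) (Nat.find_min hex hj)

lemma artinian_J_smul {R : Type u} [CommRing R] [IsLocalRing R] {p : R}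
    (hp : maximalIdeal R = Ideal.span {p}) (M : Type u) [AddCommGroup M] [Module R M]
    [IsArtinian R M] (i : R) (hi : i ∈ (⨅ n : ℕ, maximalIdeal R ^ n)) (m : M) : i • m = 0 := by
  obtain ⟨n, ⟨y, hy⟩, hyn⟩ := IsArtinian.exists_pow_succ_smul_dvd (R := R) (M := Submodule.span R {m}) p
    ⟨m, Submodule.mem_span_singleton_self m⟩
  obtain ⟨t, rfl⟩ := Submodule.mem_span_singleton.1 hy
  have h := congrArg Subtype.val hyn
  simp only [SetLike.val_smul] at h
  have hu : IsUnit (1 - p * t) := by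
    by_contra hnu
    have h1 : (1 - p * t) ∈ maximalIdeal R := (mem_maximalIdeal _).2 hnu
    have h3 : p * t ∈ maximalIdeal R := by
      rw [hp]; exact Ideal.mul_mem_right _ _ (Ideal.mem_span_singleton_self p)
    have h2 : (1 : R) ∈ maximalIdeal R := by
      have := Ideal.add_mem _ h1 h3
      rwa [sub_add_cancel] at this
    exact (Ideal.ne_top_iff_one _).1 (maximalIdeal.isMaximal R).ne_top h2
  have h0 : (1 - p * t) • (p ^ n • m) = 0 := by
    have e : (p * t) • (p ^ n • m) = p ^ n • m := by
      nth_rewrite 2 [← h]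
      rw [smul_smul, smul_smul]
      congr 1
      rw [pow_succ]; ring
    rw [sub_smul, one_smul, e, sub_self]
  have h1 := (hu.smul_eq_zero).1 h0
  obtain ⟨s, rfl⟩ := (mem_J_iff hp i).1 hi n
  rw [mul_comm, mul_smul, h1, smul_zero]

/-- Bounded modules are RD-injective when the maximal ideal is principal. -/
lemma ext_of_bounded {R : Type u} [CommRing R] [IsLocalRing R] {p : R}
    (hp : maximalIdeal R = Ideal.span {p}) (M : Type u) [AddCommGroup M] [Module R M]
    (N : ℕ) (hN : ∀ m : M, p ^ N • m = 0) {H F : Type u} [AddCommGroup H] [Module R H]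
    [AddCommGroup F] [Module R F] (f : H →ₗ[R] F) (hf : IsRDMap f)
    (g : H →ₗ[R] M) : ∃ k : F →ₗ[R] M, k.comp f = g := by
  classical
  let T : Set (Submodule R F) := {C | (∀ z : F, p ^ N • z ∈ C) ∧ (∀ h, f h ∈ C → g h = 0) ∧
    ∀ (k : ℕ) (y : F), p ^ k • y ∈ LinearMap.range f ⊔ C →
      ∃ s ∈ LinearMap.range f ⊔ C, ∃ z : F, p ^ k • (y - s) = p ^ N • z}
  have hbase : LinearMap.range (p ^ N • (LinearMap.id : F →ₗ[R] F)) ∈ T := by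
    refine ⟨fun z => ⟨z, by simp⟩, ?_, ?_⟩
    · rintro h ⟨z, hz⟩
      obtain ⟨h', rfl⟩ := hf.2 (p ^ N) h z (by simpa using hz.symm)
      rw [map_smul, hN]
    · intro k y hy
      by_cases hk : k ≤ N
      · obtain ⟨_, ⟨h, rfl⟩, _, ⟨z, rfl⟩, hhz⟩ := Submodule.mem_sup.1 hy
        have e : p ^ N = p ^ k * p ^ (N - k) := by rw [← pow_add]; congr 1; omega
        simp only [LinearMap.smul_apply, LinearMap.id_apply] at hhz
        have h2 : f h = p ^ k • (y - p ^ (N - k) • z) := by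
          rw [smul_sub, ← hhz, smul_smul, ← e, add_sub_cancel_right]
        obtain ⟨h', rfl⟩ := hf.2 _ h _ h2
        refine ⟨f h', Submodule.mem_sup_left ⟨h', rfl⟩, z, ?_⟩
        rw [smul_sub, ← map_smul, ← hhz, add_sub_cancel_left]
      · refine ⟨0, Submodule.zero_mem _, p ^ (k - N) • y, ?_⟩
        rw [sub_zero, smul_smul, ← pow_add]
        congr 2; omega
  obtain ⟨C, -, hC⟩ := zorn_le_nonempty₀ T (by
    intro c hcT hc y hy
    have hmem : ∀ x, x ∈ sSup c ↔ ∃ D ∈ c, x ∈ D := fun x =>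
      Submodule.mem_sSup_of_directed ⟨y, hy⟩ hc.directedOn
    refine ⟨sSup c, ⟨fun z => ?_, ?_, ?_⟩, fun z hz => le_sSup hz⟩
    · exact (hmem _).2 ⟨y, hy, (hcT hy).1 z⟩
    · intro h hh
      obtain ⟨D, hD, hhD⟩ := (hmem _).1 hh
      exact (hcT hD).2.1 h hhD
    · intro k x hx
      obtain ⟨a, ha, b, hb, hab⟩ := Submodule.mem_sup.1 hx
      obtain ⟨D, hD, hbD⟩ := (hmem _).1 hb
      obtain ⟨s, hs, z, hz⟩ := (hcT hD).2.2 k x (hab ▸ Submodule.add_mem_sup ha hbD)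
      exact ⟨s, sup_le_sup_left (le_sSup hD) _ hs, z, hz⟩) _ hbase
  obtain ⟨⟨hC1, hC2, hC3⟩, hmax⟩ := hC
  have htop : LinearMap.range f ⊔ C = ⊤ := by
    by_contra hne
    set S := LinearMap.range f ⊔ C with hS
    have hCS : C ≤ S := le_sup_right
    have hex : ∃ n : ℕ, ∀ x : F, p ^ n • x ∈ S := ⟨N, fun x => hCS (hC1 x)⟩
    obtain ⟨n, hn⟩ : ∃ n, n + 1 = Nat.find hex := by
      refine ⟨Nat.find hex - 1, ?_⟩
      have : Nat.find hex ≠ 0 := by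
        intro h0
        apply hne
        rw [eq_top_iff]
        intro x _
        have := Nat.find_spec hex x
        rw [h0] at this
        simpa using this
      omega
    have hall : ∀ x : F, p ^ (n + 1) • x ∈ S := by
      rw [hn]; exact Nat.find_spec hex
    have hnot : ¬ ∀ x : F, p ^ n • x ∈ S := Nat.find_min hex (by omega)
    have hnN : n + 1 ≤ N := by
      rw [hn]; exact Nat.find_le fun x => hCS (hC1 x)
    push Not at hnot
    obtain ⟨x0, hx0⟩ := hnot
    obtain ⟨s0, hs0, z0, hz0⟩ := hC3 (n + 1) x0 (hall x0)
    set x := x0 - s0 with hx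
    have hxS : p ^ n • x ∉ S := by
      intro h
      apply hx0
      have := S.add_mem h (S.smul_mem (p ^ n) hs0)
      rwa [hx, smul_sub, sub_add_cancel] at this
    have hxC : p ^ (n + 1) • x ∈ C := by rw [hz0]; exact hC1 z0
    -- multiples of `x` inside `S` lie in `C`
    have hrx : ∀ r : R, r • x ∈ S → r • x ∈ C := by
      intro r hr
      rcases pow_or hp r (n + 1) with ⟨t, rfl⟩ | ⟨j, hj, v, hv, rfl⟩
      · rw [mul_comm, mul_smul]; exact C.smul_mem _ hxC
      · exfalso
        apply hxS
        rw [mul_smul, S.smul_mem_iff_of_isUnit hv] at hr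
        have := S.smul_mem (p ^ (n - j)) hr
        rw [smul_smul, ← pow_add] at this
        rwa [show n - j + j = n by omega] at this
    have hx_in : x ∈ C ⊔ Submodule.span R {x} :=
      Submodule.mem_sup_right (Submodule.mem_span_singleton_self x)
    have hnew : C ⊔ Submodule.span R {x} ∈ T := by
      refine ⟨fun z => Submodule.mem_sup_left (hC1 z), ?_, ?_⟩
      · intro h hh
        obtain ⟨c, hc, _, hy, hcy⟩ := Submodule.mem_sup.1 hh
        obtain ⟨r, rfl⟩ := Submodule.mem_span_singleton.1 hy
        apply hC2
        rw [← hcy]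
        refine C.add_mem hc (hrx r ?_)
        have : r • x = f h - c := by rw [← hcy]; abel
        rw [this]
        exact S.sub_mem (Submodule.mem_sup_left ⟨h, rfl⟩) (hCS hc)
      · intro k y hy
        rw [← sup_assoc, ← hS] at hy ⊢
        obtain ⟨s, hs, _, hr, hsr⟩ := Submodule.mem_sup.1 hy
        obtain ⟨r, rfl⟩ := Submodule.mem_span_singleton.1 hr
        have hSle : S ≤ S ⊔ Submodule.span R {x} := le_sup_left
        by_cases hrS : r • x ∈ S
        · obtain ⟨s', hs', z, hz⟩ := hC3 k y (hsr ▸ S.add_mem hs hrS)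
          exact ⟨s', hSle hs', z, hz⟩
        rcases pow_or hp r k with ⟨t, rfl⟩ | ⟨j, hj, v, hv, rfl⟩
        · have h1 : p ^ k • (y - t • x) = s := by
            rw [smul_sub, ← hsr, smul_smul, add_sub_cancel_right]
          obtain ⟨s', hs', z, hz⟩ := hC3 k (y - t • x) (h1 ▸ hs)
          refine ⟨t • x + s', Submodule.add_mem _ (Submodule.mem_sup_right
            (Submodule.smul_mem _ _ (Submodule.mem_span_singleton_self x))) (hSle hs'), z, ?_⟩
          rw [← hz]; congr 1; abel
        · exfalso
          have hjn : j ≤ n := by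
            by_contra hlt
            apply hrS
            rw [show j = (j - (n + 1)) + (n + 1) by omega, pow_add, ← mul_assoc, mul_smul]
            exact S.smul_mem _ (hCS hxC)
          apply hxS
          rw [← S.smul_mem_iff_of_isUnit hv]
          have e1 : v • p ^ n • x = p ^ (n - j) • ((v * p ^ j) • x) := by
            rw [smul_smul, smul_smul]
            congr 1
            rw [show p ^ n = p ^ (n - j) * p ^ j by rw [← pow_add]; congr 1; omega]
            ring
          have e2 : p ^ (n - j) • ((v * p ^ j) • x) = p ^ (n - j) • p ^ k • y - p ^ (n - j) • s := by
            rw [← hsr, smul_add, add_sub_cancel_left]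
          rw [e1, e2]
          refine S.sub_mem ?_ (S.smul_mem _ hs)
          rw [smul_smul, ← pow_add, show n - j + k = (k - j - 1) + (n + 1) by omega, pow_add,
            mul_smul]
          exact S.smul_mem _ (hall y)
    have hle := hmax hnew le_sup_left
    exact hxS (S.smul_mem _ (hCS (hle hx_in)))
  let φ : H →ₗ[R] F ⧸ C := C.mkQ.comp f
  have hφ : Function.Surjective φ := by
    intro y
    obtain ⟨y, rfl⟩ := Submodule.Quotient.mk_surjective _ y
    have : y ∈ LinearMap.range f ⊔ C := htop ▸ trivial
    obtain ⟨_, ⟨h, rfl⟩, c, hc, rfl⟩ := Submodule.mem_sup.1 this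
    refine ⟨h, ?_⟩
    change Submodule.Quotient.mk (f h) = _
    rw [Submodule.Quotient.mk_add, (Submodule.Quotient.mk_eq_zero C).2 hc, add_zero]
  have hker : LinearMap.ker φ ≤ LinearMap.ker g := by
    intro h hh
    exact hC2 h ((Submodule.Quotient.mk_eq_zero C).1 hh)
  let e := φ.quotKerEquivOfSurjective hφ
  refine ⟨((LinearMap.ker φ).liftQ g hker).comp (e.symm.toLinearMap.comp C.mkQ), ?_⟩
  ext h
  have : e.symm (C.mkQ (f h)) = Submodule.Quotient.mk h := by
    rw [LinearEquiv.symm_apply_eq]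
    rfl
  simp only [LinearMap.comp_apply, LinearEquiv.coe_coe]
  rw [this, Submodule.liftQ_apply]

lemma artinian_of_tower {R : Type u} [CommRing R] [IsLocalRing R] {p : R}
    (hp : maximalIdeal R = Ideal.span {p}) (M : Type u) [AddCommGroup M] [Module R M]
    (e : ℕ → M) (e0 : e 0 = 0) (es : ∀ n, p • e (n + 1) = e n)
    (hsurj : ∀ x : M, ∃ (a : R) (n : ℕ), x = a • e n) : IsArtinian R M := by
  classical
  have hpow : ∀ j n, p ^ j • e n = e (n - j) := by
    intro j
    induction j with
    | zero => intro n; simp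
    | succ j ih =>
      intro n
      rw [pow_succ', mul_smul, ih]
      rcases h : n - j with _ | k
      · rw [e0, smul_zero, show n - (j + 1) = 0 by omega, e0]
      · rw [es]; congr 1; omega
  have hform : ∀ x : M, ∃ (v : R) (n : ℕ), IsUnit v ∧ x = v • e n := by
    intro x
    obtain ⟨a, n, rfl⟩ := hsurj x
    rcases pow_or hp a n with ⟨t, rfl⟩ | ⟨j, hj, v, hv, rfl⟩
    · refine ⟨1, 0, isUnit_one, ?_⟩
      rw [mul_comm, mul_smul, hpow, Nat.sub_self, e0, smul_zero, smul_zero]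
    · exact ⟨v, n - j, hv, by rw [mul_smul, hpow]⟩
  rw [isArtinian_iff, WellFounded.wellFounded_iff_has_min]
  intro 𝒮 h𝒮
  by_cases hex : ∃ k : ℕ, ∃ N ∈ 𝒮, e k ∉ N
  · obtain ⟨N, hN, hkN⟩ := Nat.find_spec hex
    refine ⟨N, hN, fun N' hN' hlt => hlt.not_ge ?_⟩
    intro x hx
    obtain ⟨v, n, hv, rfl⟩ := hform x
    rw [Submodule.smul_mem_iff_of_isUnit _ hv] at hx ⊢
    by_contra hnot
    have hle : Nat.find hex ≤ n := Nat.find_le ⟨N', hN', hnot⟩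
    apply hkN
    have := N.smul_mem (p ^ (n - Nat.find hex)) hx
    rwa [hpow, show n - (n - Nat.find hex) = Nat.find hex by omega] at this
  · push Not at hex
    obtain ⟨N, hN⟩ := h𝒮
    refine ⟨N, hN, fun N' hN' hlt => hlt.not_ge ?_⟩
    intro x _
    obtain ⟨v, n, hv, rfl⟩ := hform x
    exact N'.smul_mem _ (hex n N' hN')

/-- The Prüfer-type module `R_p / R`. -/
lemma exists_prufer {R : Type u} [CommRing R] [IsLocalRing R] {p : R}
    (hp : maximalIdeal R = Ideal.span {p}) (hnil : ∀ n : ℕ, p ^ n ≠ 0) :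
    ∃ (M : Type u) (_ : AddCommGroup M) (_ : Module R M), IsArtinian R M ∧
      (∀ i ∈ (⨅ n : ℕ, maximalIdeal R ^ n), ∀ m : M, i • m = 0) ∧
      (∀ m : M, ∃ m', m = p • m') ∧ ∃ m : M, m ≠ 0 ∧ ∀ r ∈ maximalIdeal R, r • m = 0 := by
  let A := Localization.Away p
  let B : Submodule R A := LinearMap.range (Algebra.linearMap R A)
  let q : A := IsLocalization.Away.invSelf p
  have hq : algebraMap R A p * q = 1 := IsLocalization.Away.mul_invSelf p
  let e : ℕ → A ⧸ B := fun n => Submodule.Quotient.mk (q ^ n)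
  have e0 : e 0 = 0 := by
    rw [Submodule.Quotient.mk_eq_zero]
    exact ⟨1, by simp⟩
  have es : ∀ n, p • e (n + 1) = e n := by
    intro n
    simp only [e]
    rw [← Submodule.Quotient.mk_smul, Algebra.smul_def, pow_succ', ← mul_assoc, hq, one_mul]
  have hsurj : ∀ x : A ⧸ B, ∃ (a : R) (n : ℕ), x = a • e n := by
    intro x
    obtain ⟨z, rfl⟩ := Submodule.Quotient.mk_surjective _ x
    obtain ⟨n, a, h⟩ := IsLocalization.Away.surj p z
    refine ⟨a, n, ?_⟩
    simp only [e]
    rw [← Submodule.Quotient.mk_smul, Algebra.smul_def, ← h, mul_assoc, ← mul_pow, hq, one_pow,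
      mul_one]
  have hpn : ∀ n, p ^ n • e n = 0 := by
    intro n
    simp only [e]
    rw [← Submodule.Quotient.mk_smul, Algebra.smul_def, map_pow, ← mul_pow, hq, one_pow]
    rw [Submodule.Quotient.mk_eq_zero]
    exact ⟨1, by simp⟩
  refine ⟨A ⧸ B, inferInstance, inferInstance, artinian_of_tower hp _ e e0 es hsurj, ?_, ?_,
    e 1, ?_, ?_⟩
  · intro i hi m
    obtain ⟨a, n, rfl⟩ := hsurj m
    obtain ⟨s, rfl⟩ := (mem_J_iff hp i).1 hi n
    rw [smul_smul, show p ^ n * s * a = (s * a) * p ^ n by ring, mul_smul, hpn, smul_zero]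
  · intro m
    obtain ⟨a, n, rfl⟩ := hsurj m
    exact ⟨a • e (n + 1), by rw [smul_comm, es]⟩
  · intro h
    rw [Submodule.Quotient.mk_eq_zero] at h
    obtain ⟨r, hr⟩ := h
    have h1 : algebraMap R A (1 - p * r) = 0 := by
      rw [map_sub, map_mul, map_one]
      rw [Algebra.linearMap_apply, pow_one] at hr
      rw [hr, hq, sub_self]
    obtain ⟨⟨_, k, rfl⟩, hk⟩ := (IsLocalization.map_eq_zero_iff (Submonoid.powers p) A _).1 h1
    have hu : IsUnit (1 - p * r) := by
      by_contra hnu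
      have h1 : (1 - p * r) ∈ maximalIdeal R := (mem_maximalIdeal _).2 hnu
      have h3 : p * r ∈ maximalIdeal R := by
        rw [hp]; exact Ideal.mul_mem_right _ _ (Ideal.mem_span_singleton_self p)
      have h2 : (1 : R) ∈ maximalIdeal R := by
        have := Ideal.add_mem _ h1 h3
        rwa [sub_add_cancel] at this
      exact (Ideal.ne_top_iff_one _).1 (maximalIdeal.isMaximal R).ne_top h2
    exact hnil k ((hu.mul_left_eq_zero).1 hk)
  · intro r hr
    rw [hp] at hr
    obtain ⟨t, rfl⟩ := Ideal.mem_span_singleton'.1 hr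
    rw [mul_smul, es 0, e0, smul_zero]

/-- With `P` directed, either `P` is principal or `P = P ^ 2`. -/
lemma principal_or_idem {R : Type u} [CommRing R] [IsLocalRing R]
    (hP : DirIdeal (maximalIdeal R)) :
    (∃ p, maximalIdeal R = Ideal.span {p}) ∨ maximalIdeal R ≤ maximalIdeal R * maximalIdeal R := by
  by_cases h : maximalIdeal R ≤ maximalIdeal R * maximalIdeal R
  · exact Or.inr h
  · left
    obtain ⟨p, hp, hp2⟩ := SetLike.not_le_iff_exists.1 h
    refine ⟨p, le_antisymm (fun a ha => ?_) ((Ideal.span_singleton_le_iff_mem _).2 hp)⟩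
    obtain ⟨c, hc, ⟨v, rfl⟩, hca⟩ := hP p hp a ha
    have hv : IsUnit v := by
      by_contra hv
      exact hp2 (Ideal.mul_mem_mul hc ((mem_maximalIdeal _).2 hv))
    rw [Ideal.mem_span_singleton]
    exact (hv.mul_right_dvd).2 hca

lemma J_eq_of_idem {R : Type u} [CommRing R] [IsLocalRing R]
    (h : maximalIdeal R ≤ maximalIdeal R * maximalIdeal R) :
    (⨅ n : ℕ, maximalIdeal R ^ n) = maximalIdeal R := by
  refine le_antisymm ((iInf_le _ 1).trans (by rw [pow_one])) (le_iInf fun n => ?_)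
  induction n with
  | zero => simp
  | succ n ih =>
    rw [pow_succ]
    exact h.trans (Ideal.mul_mono_left ih)

/-- `P`-torsion modules are relatively divisible over `R ⧸ P`. -/
lemma divOver_P {R : Type u} [CommRing R] [IsLocalRing R] (M : Type u) [AddCommGroup M]
    [Module R M] (h : ∀ i ∈ maximalIdeal R, ∀ m : M, i • m = 0) : DivOver (maximalIdeal R) M := by
  refine ⟨h, fun K hK hne => ?_⟩
  have : K = ⊤ := by
    by_contra hK'
    exact hne ((maximalIdeal.isMaximal R).eq_of_le hK' hK).symm
  subst this
  exact ⟨1, trivial, by simp, fun m => ⟨m, by simp⟩⟩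

lemma artinian_P_smul {R : Type u} [CommRing R] [IsLocalRing R]
    (h : maximalIdeal R ≤ maximalIdeal R * maximalIdeal R) (M : Type u) [AddCommGroup M]
    [Module R M] [IsArtinian R M] : ∀ i ∈ maximalIdeal R, ∀ m : M, i • m = 0 := by
  let S : Submodule R M := Submodule.torsionBySet R M (maximalIdeal R)
  have hS : ∀ m, m ∈ S ↔ ∀ i ∈ maximalIdeal R, i • m = 0 := fun m => by
    simp [S, Submodule.mem_torsionBySet_iff]
  suffices hT : S = ⊤ by
    intro i hi m
    exact (hS m).1 (hT ▸ trivial) i hi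
  by_contra hne
  have hwf : WellFounded ((· < ·) : Submodule R M → Submodule R M → Prop) :=
    (isArtinian_iff R M).1 inferInstance
  obtain ⟨T, hST, hmin⟩ := hwf.has_min {T | S < T} ⟨⊤, lt_top_iff_ne_top.2 hne⟩
  replace hST : S < T := hST
  obtain ⟨x, hxT, hxS⟩ := SetLike.exists_of_lt hST
  have hax : ∀ a ∈ maximalIdeal R, a • x ∈ S := by
    intro a ha
    by_contra hax
    have hlt : S < S ⊔ Submodule.span R {a • x} := by
      refine lt_of_le_of_ne le_sup_left fun he => hax ?_
      rw [he]
      exact Submodule.mem_sup_right (Submodule.mem_span_singleton_self _)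
    have hle : S ⊔ Submodule.span R {a • x} ≤ T :=
      sup_le hST.le ((Submodule.span_singleton_le_iff_mem _ _).2 (T.smul_mem _ hxT))
    have heq : S ⊔ Submodule.span R {a • x} = T := by
      by_contra hne'
      exact hmin _ hlt (lt_of_le_of_ne hle hne')
    rw [← heq] at hxT
    obtain ⟨s, hs, _, hy, hsy⟩ := Submodule.mem_sup.1 hxT
    obtain ⟨r, rfl⟩ := Submodule.mem_span_singleton.1 hy
    have hu : IsUnit (1 - r * a) := by
      by_contra hnu
      have h1 : (1 - r * a) ∈ maximalIdeal R := (mem_maximalIdeal _).2 hnu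
      have h2 : (1 : R) ∈ maximalIdeal R := by
        have := Ideal.add_mem _ h1 (Ideal.mul_mem_left _ r ha)
        rwa [sub_add_cancel] at this
      exact (Ideal.ne_top_iff_one _).1 (maximalIdeal.isMaximal R).ne_top h2
    apply hxS
    rw [← Submodule.smul_mem_iff_of_isUnit S hu]
    have : (1 - r * a) • x = s := by
      rw [sub_smul, one_smul, mul_smul, sub_eq_iff_eq_add]
      exact hsy.symm
    rwa [this]
  apply hxS
  rw [hS]
  intro i hi
  refine Submodule.mul_induction_on (C := fun i => i • x = 0) (h hi) ?_ ?_
  · intro a ha b hb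
    rw [mul_smul]
    exact (hS _).1 (hax b hb) a ha
  · intro a b ha hb
    rw [add_smul, ha, hb, add_zero]

lemma rdInjective_of_flat {R : Type u} [CommRing R] [IsLocalRing R]
    (hP : RDFlatC R (R ⧸ maximalIdeal R)) (hJ : RDFlatC R (R ⧸ (⨅ n : ℕ, maximalIdeal R ^ n)))
    (M : Type u) [AddCommGroup M] [Module R M] [IsArtinian R M] : RDInjectiveC R M := by
  intro H F _ _ _ _ f hf1 hf2 g
  rcases principal_or_idem (dir_of_rdFlat _ le_rfl hP) with ⟨p, hp⟩ | hidem
  · have hJf := (rdFlat_quot_iff _).1 hJ H F f ⟨hf1, hf2⟩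
    have hJM := artinian_J_smul hp M
    obtain ⟨N, hN⟩ := IsArtinian.range_smul_pow_stabilizes (R := R) M p
    let D : Submodule R M := LinearMap.range (p ^ N • (LinearMap.id : M →ₗ[R] M))
    have hD : DivOver (⨅ n : ℕ, maximalIdeal R ^ n) D := by
      refine divOver_J hp D (fun i hi m => Subtype.ext (hJM i hi m)) ?_
      rintro ⟨m, hm⟩
      have hm' : m ∈ LinearMap.range (p ^ (N + 1) • (LinearMap.id : M →ₗ[R] M)) := by
        rw [← hN (N + 1) (by omega)]; exact hm
      obtain ⟨y, hy⟩ := hm'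
      refine ⟨⟨p ^ N • y, ⟨y, by simp⟩⟩, Subtype.ext ?_⟩
      simp only [LinearMap.smul_apply, LinearMap.id_apply] at hy
      change m = p • p ^ N • y
      rw [← hy, smul_smul, pow_succ']
    obtain ⟨ρ, hρ⟩ := ext_of_divOver _ D hD D.subtype (by
      intro d hd
      have : ((⨅ n : ℕ, maximalIdeal R ^ n) • (⊤ : Submodule R M)) = ⊥ := by
        rw [eq_bot_iff, Submodule.smul_le]
        intro r hr n _
        simpa using hJM r hr n
      rw [this, Submodule.mem_bot] at hd
      have : d = 0 := Subtype.ext hd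
      rw [this]; exact Submodule.zero_mem _) LinearMap.id
    have hρ' : ∀ d : D, ρ d = d := fun d => LinearMap.congr_fun hρ d
    obtain ⟨k1, hk1⟩ := ext_of_divOver _ D hD f hJf (ρ.comp g)
    let κ : M →ₗ[R] LinearMap.ker ρ :=
      (LinearMap.id - D.subtype.comp ρ).codRestrict (LinearMap.ker ρ) (by
        intro m
        simp [LinearMap.mem_ker, hρ'])
    obtain ⟨k2, hk2⟩ := ext_of_bounded hp (LinearMap.ker ρ) N (by
      rintro ⟨m, hm⟩
      apply Subtype.ext
      change p ^ N • m = 0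
      have hmem : p ^ N • m ∈ D := ⟨m, by simp⟩
      have := hρ' ⟨_, hmem⟩
      simp only [map_smul] at this
      rw [LinearMap.mem_ker.1 hm, smul_zero] at this
      exact (congrArg Subtype.val this).symm) f ⟨hf1, hf2⟩ (κ.comp g)
    refine ⟨D.subtype.comp k1 + (LinearMap.ker ρ).subtype.comp k2, ?_⟩
    ext h
    have h1 : k1 (f h) = ρ (g h) := LinearMap.congr_fun hk1 h
    have h2 : k2 (f h) = κ (g h) := LinearMap.congr_fun hk2 h
    change ((k1 (f h) : D) : M) + ((k2 (f h) : LinearMap.ker ρ) : M) = g h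
    rw [h1, h2]
    change ((ρ (g h) : D) : M) + (g h - ((ρ (g h) : D) : M)) = g h
    abel
  · exact ext_of_divOver _ M (divOver_P M (artinian_P_smul hidem M)) f
      ((rdFlat_quot_iff _).1 hP H F f ⟨hf1, hf2⟩) g

lemma flat_of_rdInjective {R : Type u} [CommRing R] [IsLocalRing R]
    (h : ∀ (M : Type u) [AddCommGroup M] [Module R M], IsArtinian R M → RDInjectiveC R M) :
    RDFlatC R (R ⧸ maximalIdeal R) ∧ RDFlatC R (R ⧸ (⨅ n : ℕ, maximalIdeal R ^ n)) := by
  have hkill : ∀ i ∈ maximalIdeal R, ∀ m : R ⧸ maximalIdeal R, i • m = 0 := by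
    intro i hi m
    obtain ⟨r, rfl⟩ := Submodule.Quotient.mk_surjective _ m
    rw [← Submodule.Quotient.mk_smul, Submodule.Quotient.mk_eq_zero]
    exact Ideal.mul_mem_right _ _ hi
  have hart : IsArtinian R (R ⧸ maximalIdeal R) := by
    have : IsSimpleModule R (R ⧸ maximalIdeal R) := by
      rw [isSimpleModule_iff_isCoatom]
      exact Ideal.isMaximal_def.1 (maximalIdeal.isMaximal R)
    infer_instance
  have hP : RDFlatC R (R ⧸ maximalIdeal R) :=
    rdFlat_of_cogen _ _ (divOver_P _ hkill) (Submodule.Quotient.mk 1)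
      (by
        rw [Ne, Submodule.Quotient.mk_eq_zero]
        exact (Ideal.ne_top_iff_one _).1 (maximalIdeal.isMaximal R).ne_top)
      (fun r hr => hkill r hr _) (h _ hart)
  refine ⟨hP, ?_⟩
  rcases principal_or_idem (dir_of_rdFlat _ le_rfl hP) with ⟨p, hp⟩ | hidem
  · by_cases hnil : ∀ n : ℕ, p ^ n ≠ 0
    · obtain ⟨M, _, _, hM, hJM, hdiv, m, hm, hPm⟩ := exists_prufer hp hnil
      exact rdFlat_of_cogen _ M (divOver_J hp M hJM hdiv) m hm hPm (h M hM)
    · push Not at hnil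
      obtain ⟨n, hn⟩ := hnil
      apply rdFlat_of_dir
      intro a ha b hb
      refine ⟨0, Ideal.zero_mem _, ?_, ?_⟩
      · simpa [hn] using (mem_J_iff hp a).1 ha n
      · simpa [hn] using (mem_J_iff hp b).1 hb n
  · rw [J_eq_of_idem hidem]
    exact hP

lemma rdFlat_iff_dir {R : Type u} [CommRing R] [IsLocalRing R] (I : Ideal R)
    (hIP : I ≤ maximalIdeal R) : RDFlatC R (R ⧸ I) ↔ DirIdeal I :=
  ⟨dir_of_rdFlat I hIP, rdFlat_of_dir I⟩

end RDHelpers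


/-- Let `R` be a commutative local ring with maximal ideal `P` and `J = ∩ₙ Pⁿ`.
Then: every artinian `R`-module is RD-injective iff both `R/P` and `R/J` are RD-flat,
iff the set of nonzero principal ideals contained in `P` is directed and the set of
nonzero principal ideals contained in `J` is directed. -/
theorem artinian_rdInjective_iff (R : Type u) [CommRing R] [IsLocalRing R] :
    ((∀ (M : Type u) [AddCommGroup M] [Module R M],
        IsArtinian R M → RDInjectiveC R M) ↔
      (RDFlatC R (R ⧸ maximalIdeal R) ∧
        RDFlatC R (R ⧸ (⨅ n : ℕ, maximalIdeal R ^ n)))) ∧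
    ((RDFlatC R (R ⧸ maximalIdeal R) ∧
        RDFlatC R (R ⧸ (⨅ n : ℕ, maximalIdeal R ^ n))) ↔
      ((∀ a b : R, a ≠ 0 → b ≠ 0 →
          Ideal.span {a} ≤ maximalIdeal R → Ideal.span {b} ≤ maximalIdeal R →
          ∃ c : R, c ≠ 0 ∧ Ideal.span {c} ≤ maximalIdeal R ∧
            Ideal.span {a} ≤ Ideal.span {c} ∧ Ideal.span {b} ≤ Ideal.span {c}) ∧
        (∀ a b : R, a ≠ 0 → b ≠ 0 →
          Ideal.span {a} ≤ (⨅ n : ℕ, maximalIdeal R ^ n) →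
          Ideal.span {b} ≤ (⨅ n : ℕ, maximalIdeal R ^ n) →
          ∃ c : R, c ≠ 0 ∧ Ideal.span {c} ≤ (⨅ n : ℕ, maximalIdeal R ^ n) ∧
            Ideal.span {a} ≤ Ideal.span {c} ∧ Ideal.span {b} ≤ Ideal.span {c}))) := by
  rw [← dirIdeal_iff, ← dirIdeal_iff, rdFlat_iff_dir _ le_rfl,
    rdFlat_iff_dir _ ((iInf_le _ 1).trans (by rw [pow_one]))]
  refine ⟨⟨fun h => ?_, fun h M _ _ hM => ?_⟩, Iff.rfl⟩
  · have := flat_of_rdInjective h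
    exact ⟨dir_of_rdFlat _ le_rfl this.1,
      dir_of_rdFlat _ ((iInf_le _ 1).trans (by rw [pow_one])) this.2⟩
  · exact rdInjective_of_flat (rdFlat_of_dir _ h.1) (rdFlat_of_dir _ h.2) M
end
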